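/- arXiv:2111.11671 — 10 statements merged into one kernel-verified Lean document; each statement's English description precedes it below -/
import Mathlib

section
/- For every integer s ≥ 0, the complete graph K_{24s+13} admits a triangular biembedding: there exist two spanning subgraphs G₁ and G₂ of the complete graph on 24s+13 vertices whose edge sets partition the edge set of the complete graph, such that each of G₁ and G₂ admits a triangular rotation system. -/
/-- A rotation system on a simple graph `G`: each vertex `v` is assigned a permutation of the
vertex set that fixes all non-neighbors of `v`, maps neighbors of `v` to neighbors of `v`,
and acts as a single cycle on the neighborhood of `v` (expressed here as transitivity of the
cyclic group generated by the permutation on the neighborhood). -/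
structure RotationSystem {V : Type*} (G : SimpleGraph V) where
  ρ : V → Equiv.Perm V
  mem_neighbor : ∀ v u : V, G.Adj v u → G.Adj v (ρ v u)
  fixes : ∀ v u : V, ¬ G.Adj v u → ρ v u = u
  single_cycle : ∀ v u w : V, G.Adj v u → G.Adj v w → ∃ k : ℕ, ((ρ v) ^ k) u = w

namespace RotationSystem

/-- The face permutation of a rotation system: the dart `(u, v)` is sent to `(v, ρ_v(u))`. -/
def facePerm {V : Type*} {G : SimpleGraph V} (R : RotationSystem G) : G.Dart → G.Dart :=
  fun d => ⟨(d.snd, R.ρ d.snd d.fst), R.mem_neighbor d.snd d.fst d.adj.symm⟩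

/-- A rotation system is triangular if every face has length 3, i.e. every dart has minimal
period 3 under the face permutation. -/
def Triangular {V : Type*} {G : SimpleGraph V} (R : RotationSystem G) : Prop :=
  ∀ d : G.Dart, Function.minimalPeriod R.facePerm d = 3

/-- The number of faces of a rotation system: the number of orbits of the face permutation on
the set of darts (an orbit is recorded as the set of forward iterates of a dart). -/
noncomputable def numFaces {V : Type*} {G : SimpleGraph V} (R : RotationSystem G) : ℕ :=
  Nat.card (Set.range fun d : G.Dart => Set.range fun k : ℕ => R.facePerm^[k] d)

end RotationSystem

/-- The circulant graph `C(n, X)` on vertex set `ℤ/nℤ`: `i` and `j` are adjacent iff `i ≠ j`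
and `i - j ≡ ±x (mod n)` for some `x ∈ X`. -/
def circulant (n : ℕ) (X : Set ℕ) : SimpleGraph (ZMod n) :=
  SimpleGraph.fromRel (fun i j => ∃ x ∈ X, i - j = (x : ZMod n))

open Function

/-- A self-map under which every point lies in the forward orbit of one periodic point has a
single cycle. -/
theorem exists_iterate_eq_of_orbit {D : Type*} {f : D → D} {d₀ d₁ : D} (hd : f d₁ = d₀)
    (hreach : ∀ d, ∃ k, f^[k] d₀ = d) (d e : D) : ∃ k, f^[k] d = e := by
  obtain ⟨i, rfl⟩ := hreach d
  obtain ⟨j, rfl⟩ := hreach e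
  obtain ⟨q, hq⟩ := hreach d₁
  have hper : IsPeriodicPt f (q + 1) d₀ := by
    rw [IsPeriodicPt, IsFixedPt, iterate_succ_apply', hq, hd]
  refine ⟨j + q * i, ?_⟩
  rw [← iterate_add_apply, show j + q * i + i = j + i * (q + 1) by ring, iterate_add_apply,
    hper.const_mul i]

/-- A map whose forward orbits are all the whole type is surjective. -/
theorem surjective_of_exists_iterate_eq {D : Type*} {f : D → D}
    (htrans : ∀ d e, ∃ k, f^[k] d = e) : Surjective f := by
  intro e
  obtain ⟨k, hk⟩ := htrans (f e) e
  exact ⟨f^[k] e, by rw [← iterate_succ_apply' f k, iterate_succ_apply, hk]⟩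

/-- A rotation system is triangular as soon as `u` is followed by `w` around `v` only if `v` is
followed by `u` around `w`. -/
theorem RotationSystem.triangular_of_rotation {V : Type*} {G : SimpleGraph V}
    (R : RotationSystem G) (h : ∀ v u, G.Adj v u → R.ρ (R.ρ v u) v = u) : R.Triangular := by
  intro d
  refine minimalPeriod_eq_prime (hp := ⟨Nat.prime_three⟩) ?_ ?_
  · have h₁ := h d.snd d.fst d.adj.symm
    have h₂ := h (R.ρ d.snd d.fst) d.snd (R.mem_neighbor _ _ d.adj.symm).symm
    rw [h₁] at h₂
    refine SimpleGraph.Dart.ext _ _ (Prod.ext ?_ ?_)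
    · exact h₁
    · change R.ρ (R.ρ (R.ρ d.snd d.fst) d.snd) (R.ρ d.snd d.fst) = d.snd
      rw [h₁, h₂]
  · intro hfix
    exact d.adj.ne (congrArg (fun e : G.Dart => e.fst) hfix).symm

section Circulant

variable {A D : Type*} [AddCommGroup A]

theorem circulantGraph_adj_iff {S : Set A} (h0 : (0 : A) ∉ S) (hneg : ∀ x ∈ S, -x ∈ S) {u v : A} :
    (SimpleGraph.circulantGraph S).Adj u v ↔ v - u ∈ S := by
  rw [SimpleGraph.circulantGraph, SimpleGraph.fromRel_adj]
  refine ⟨?_, fun h => ⟨?_, Or.inr h⟩⟩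
  · rintro ⟨-, h | h⟩
    · simpa using hneg _ h
    · exact h
  · rintro rfl
    exact h0 (by simpa using h)

/-- If the elements `val d` are cyclically arranged by `next` so that `x` followed by `y` implies
`-y` followed by `x - y`, then translating this cyclic order to every vertex gives a triangular
rotation system on the circulant graph generated by these elements. -/
theorem exists_triangular_circulantGraph [Finite D] {val : D → A} {next : D → D}
    (hinj : Injective val) (h0 : ∀ d, val d ≠ 0)
    (hnext : ∀ d, ∃ e, val e = -val (next d) ∧ val (next e) = val d - val (next d))
    (htrans : ∀ d e, ∃ k, next^[k] d = e) :
    ∃ R : RotationSystem (SimpleGraph.circulantGraph (Set.range val)), R.Triangular := by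
  classical
  have hsurj := surjective_of_exists_iterate_eq htrans
  have hneg : ∀ x ∈ Set.range val, -x ∈ Set.range val := by
    rintro _ ⟨d, rfl⟩
    obtain ⟨d, rfl⟩ := hsurj d
    obtain ⟨e, he, -⟩ := hnext d
    exact ⟨e, he⟩
  have hadj : ∀ {u v : A}, (SimpleGraph.circulantGraph (Set.range val)).Adj u v ↔
      v - u ∈ Set.range val :=
    circulantGraph_adj_iff (by rintro ⟨d, hd⟩; exact h0 d hd) hneg
  let σ : Equiv.Perm D := Equiv.ofBijective next (Finite.surjective_iff_bijective.1 hsurj)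
  let τ : Equiv.Perm A := σ.extendDomain (Equiv.ofInjective val hinj)
  have hτ : ∀ d, τ (val d) = val (next d) := fun d =>
    σ.extendDomain_apply_image (Equiv.ofInjective val hinj) d
  have hτ' : ∀ x, x ∉ Set.range val → τ x = x := fun x hx =>
    σ.extendDomain_apply_not_subtype (Equiv.ofInjective val hinj) hx
  let ρ : A → Equiv.Perm A := fun v =>
    (Equiv.subRight v).trans (τ.trans (Equiv.addRight v))
  have hρ : ∀ v u, ρ v u = τ (u - v) + v := fun v u => rfl
  have hρval : ∀ v d, ρ v (val d + v) = val (next d) + v := fun v d => by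
    rw [hρ, add_sub_cancel_right, hτ]
  have hpow : ∀ v d k, (ρ v ^ k) (val d + v) = val (next^[k] d) + v := by
    intro v d k
    induction k with
    | zero => rfl
    | succ k ih => rw [pow_succ', Equiv.Perm.mul_apply, ih, hρval, iterate_succ_apply']
  let R : RotationSystem (SimpleGraph.circulantGraph (Set.range val)) :=
    { ρ := ρ
      mem_neighbor := by
        intro v u huv
        obtain ⟨d, hd⟩ := hadj.1 huv
        rw [eq_add_of_sub_eq hd.symm, hρval]
        exact hadj.2 ⟨next d, by simp⟩
      fixes := by
        intro v u huv
        rw [hρ, hτ' _ (fun h => huv (hadj.2 h)), sub_add_cancel]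
      single_cycle := by
        intro v u w hu hw
        obtain ⟨d, hd⟩ := hadj.1 hu
        obtain ⟨e, he⟩ := hadj.1 hw
        obtain ⟨k, rfl⟩ := htrans d e
        refine ⟨k, ?_⟩
        rw [eq_add_of_sub_eq hd.symm, eq_add_of_sub_eq he.symm, hpow] }
  refine ⟨R, R.triangular_of_rotation fun v u huv => ?_⟩
  obtain ⟨d, hd⟩ := hadj.1 huv
  obtain ⟨e, he, he'⟩ := hnext d
  change ρ (ρ v u) v = u
  rw [eq_add_of_sub_eq hd.symm, hρval]
  conv_lhs => rw [show ρ (val (next d) + v) v = ρ (val (next d) + v) (val e + (val (next d) + v))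
    by rw [he]; abel_nf]
  rw [hρval, he']
  abel

end Circulant

/-- The darts of a ladder with `m` rungs whose two left ends and whose two right ends are joined to
the two ends of one additional arc. The sign in a name is the direction of traversal. -/
inductive LadderDart (m : ℕ)
  | arcPos
  | arcNeg
  | topPos (i : Fin (m + 1))
  | topNeg (i : Fin (m + 1))
  | botPos (i : Fin (m + 1))
  | botNeg (i : Fin (m + 1))
  | rungPos (i : Fin m)
  | rungNeg (i : Fin m)

namespace LadderDart

variable {m : ℕ} {A B : Type*} [AddCommGroup A] [AddCommGroup B]

/-- The darts as a disjoint union of index types. -/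
def equivSum (m : ℕ) : LadderDart m ≃ Bool ⊕ (Bool × Bool × Fin (m + 1)) ⊕ (Bool × Fin m) where
  toFun
    | arcPos => .inl true
    | arcNeg => .inl false
    | topPos i => .inr (.inl (true, true, i))
    | topNeg i => .inr (.inl (true, false, i))
    | botPos i => .inr (.inl (false, true, i))
    | botNeg i => .inr (.inl (false, false, i))
    | rungPos i => .inr (.inr (true, i))
    | rungNeg i => .inr (.inr (false, i))
  invFun
    | .inl true => arcPos
    | .inl false => arcNeg
    | .inr (.inl (true, true, i)) => topPos i
    | .inr (.inl (true, false, i)) => topNeg i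
    | .inr (.inl (false, true, i)) => botPos i
    | .inr (.inl (false, false, i)) => botNeg i
    | .inr (.inr (true, i)) => rungPos i
    | .inr (.inr (false, i)) => rungNeg i
  left_inv := by rintro (_ | _ | _ | _ | _ | _ | _ | _) <;> rfl
  right_inv := by rintro ((_ | _) | ⟨_ | _, _ | _, _⟩ | ⟨_ | _, _⟩) <;> rfl

instance : Fintype (LadderDart m) := Fintype.ofEquiv _ (equivSum m).symm

theorem card_eq (m : ℕ) : Fintype.card (LadderDart m) = 6 * m + 6 := by
  rw [Fintype.card_congr (equivSum m)]
  simp only [Fintype.card_sum, Fintype.card_prod, Fintype.card_bool, Fintype.card_fin]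
  ring

/-- The current on a dart: the top rails carry `h`, the bottom rails carry `c - h`, and the rungs
and the arc are determined by Kirchhoff's current law. -/
def current (h : Fin (m + 1) → A) (c : A) : LadderDart m → A
  | arcPos => c
  | arcNeg => -c
  | topPos i => h i
  | topNeg i => -h i
  | botPos i => c - h i
  | botNeg i => h i - c
  | rungPos i => h i.succ - h i.castSucc
  | rungNeg i => h i.castSucc - h i.succ

/-- The face permutation of the ladder: the rails are traversed straight ahead in the positive
direction and by zigzags through the rungs in the negative direction. -/
def next : LadderDart m → LadderDart m
  | arcPos => topPos 0
  | arcNeg => topNeg (Fin.last m)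
  | topPos i => Fin.lastCases (motive := fun _ => LadderDart m) (botNeg (Fin.last m))
      (fun j => topPos j.succ) i
  | topNeg i => Fin.cases (motive := fun _ => LadderDart m) (botPos 0) rungNeg i
  | botPos i => Fin.lastCases (motive := fun _ => LadderDart m) arcPos (fun j => botPos j.succ) i
  | botNeg i => Fin.cases (motive := fun _ => LadderDart m) arcNeg rungPos i
  | rungPos i => topNeg i.castSucc
  | rungNeg i => botNeg i.castSucc

theorem current_next (h : Fin (m + 1) → A) (c : A) (d : LadderDart m) :
    ∃ e, current h c e = -current h c (next d) ∧
      current h c (next e) = current h c d - current h c (next d) := by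
  cases d with
  | arcPos => exact ⟨topNeg 0, by simp [current, next], by simp [current, next]⟩
  | arcNeg => exact ⟨topPos (Fin.last m), by simp [current, next], by simp [current, next]; abel⟩
  | topPos i =>
    induction i using Fin.lastCases with
    | last => exact ⟨botPos (Fin.last m), by simp [current, next], by simp [current, next]⟩
    | cast j => exact ⟨topNeg j.succ, by simp [current, next], by simp [current, next]⟩
  | topNeg i =>
    induction i using Fin.cases with
    | zero => exact ⟨botNeg 0, by simp [current, next], by simp [current, next]; abel⟩
    | succ j => exact ⟨rungPos j, by simp [current, next], by simp [current, next]; abel⟩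
  | botPos i =>
    induction i using Fin.lastCases with
    | last => exact ⟨arcNeg, by simp [current, next], by simp [current, next]⟩
    | cast j => exact ⟨botNeg j.succ, by simp [current, next], by simp [current, next]⟩
  | botNeg i =>
    induction i using Fin.cases with
    | zero => exact ⟨arcPos, by simp [current, next], by simp [current, next]⟩
    | succ j => exact ⟨rungNeg j, by simp [current, next], by simp [current, next]⟩
  | rungPos i => exact ⟨topPos i.castSucc, by simp [current, next], by simp [current, next]⟩
  | rungNeg i => exact ⟨botPos i.castSucc, by simp [current, next], by simp [current, next]⟩

theorem exists_current_eq_neg (h : Fin (m + 1) → A) (c : A) (d : LadderDart m) :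
    ∃ e, current h c e = -current h c d := by
  cases d with
  | arcPos => exact ⟨arcNeg, rfl⟩
  | arcNeg => exact ⟨arcPos, by simp [current]⟩
  | topPos i => exact ⟨topNeg i, rfl⟩
  | topNeg i => exact ⟨topPos i, by simp [current]⟩
  | botPos i => exact ⟨botNeg i, by simp [current]⟩
  | botNeg i => exact ⟨botPos i, by simp [current]⟩
  | rungPos i => exact ⟨rungNeg i, by simp [current]⟩
  | rungNeg i => exact ⟨rungPos i, by simp [current]⟩

theorem current_map (f : A →+ B) (h : Fin (m + 1) → A) (c : A) (d : LadderDart m) :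
    current (fun i => f (h i)) (f c) d = f (current h c d) := by
  cases d <;> simp [current]

/-- With an even number of rungs, the ladder has a single face. -/
theorem exists_iterate_next_eq (hm : Even m) (d e : LadderDart m) : ∃ k, next^[k] d = e := by
  refine exists_iterate_eq_of_orbit (d₀ := arcPos) (d₁ := botPos (Fin.last m)) (by simp [next])
    ?_ d e
  let P : LadderDart m → Prop := fun d => ∃ k, next^[k] arcPos = d
  have step : ∀ {x y : LadderDart m}, P x → next x = y → P y := by
    rintro x _ ⟨k, rfl⟩ rfl
    exact ⟨k + 1, iterate_succ_apply' _ _ _⟩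
  have hTop : ∀ i, P (topPos i) := by
    intro i
    induction i using Fin.induction with
    | zero => exact ⟨1, rfl⟩
    | succ i ih => exact step ih (by simp [next])
  have hBotLast : P (botNeg (Fin.last m)) := step (hTop (Fin.last m)) (by simp [next])
  have fromBot : ∀ {i : Fin m}, P (botNeg i.succ) → P (rungPos i) ∧ P (topNeg i.castSucc) :=
    fun h => ⟨step h rfl, step (step h rfl) rfl⟩
  have fromTop : ∀ {i : Fin m}, P (topNeg i.succ) → P (rungNeg i) ∧ P (botNeg i.castSucc) :=
    fun h => ⟨step h rfl, step (step h rfl) rfl⟩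
  have hBotNeg : ∀ j i (hi : i + 2 * j = m), P (botNeg ⟨i, by omega⟩) := by
    intro j
    induction j with
    | zero => rintro i rfl; exact hBotLast
    | succ j ih =>
      intro i hi
      exact (fromTop (i := ⟨i, by omega⟩)
        (fromBot (i := ⟨i + 1, by omega⟩) (ih (i + 2) (by omega))).2).2
  obtain ⟨q, hq⟩ := hm
  have hArc : P arcNeg := step (hBotNeg q 0 (by omega)) rfl
  have hTopNeg : ∀ j i (hi : i + 2 * j = m), P (topNeg ⟨i, by omega⟩) := by
    intro j
    induction j with
    | zero => rintro i rfl; exact step hArc rfl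
    | succ j ih =>
      intro i hi
      exact (fromBot (i := ⟨i, by omega⟩)
        (fromTop (i := ⟨i + 1, by omega⟩) (ih (i + 2) (by omega))).2).2
  have hBot : ∀ i, P (botPos i) := by
    intro i
    induction i using Fin.induction with
    | zero => exact step (hTopNeg q 0 (by omega)) rfl
    | succ i ih => exact step ih (by simp [next])
  have hNeg : ∀ i, P (topNeg i) ∧ P (botNeg i) := by
    rintro ⟨i, hi⟩
    rcases Nat.even_or_odd' i with ⟨r, hr | hr⟩
    · exact ⟨hTopNeg (q - r) i (by omega), hBotNeg (q - r) i (by omega)⟩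
    · exact ⟨(fromBot (i := ⟨i, by omega⟩) (hBotNeg (q - r - 1) (i + 1) (by omega))).2,
        (fromTop (i := ⟨i, by omega⟩) (hTopNeg (q - r - 1) (i + 1) (by omega))).2⟩
  intro d
  cases d with
  | arcPos => exact ⟨0, rfl⟩
  | arcNeg => exact hArc
  | topPos i => exact hTop i
  | topNeg i => exact (hNeg i).1
  | botPos i => exact hBot i
  | botNeg i => exact (hNeg i).2
  | rungPos i => exact (fromBot (hNeg i.succ).2).1
  | rungNeg i => exact (fromTop (hNeg i.succ).1).1

end LadderDart

/-- If a map from `D` to a finite group hits every nonzero element and `D` has as many elements as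
there are nonzero elements, then the map is injective and avoids zero. -/
theorem injective_and_ne_zero_of_card {A D : Type*} [Fintype A] [Zero A] [Fintype D] {g : D → A}
    (hcard : Fintype.card D + 1 = Fintype.card A) (hg : ∀ x ≠ 0, ∃ d, g d = x) :
    Injective g ∧ ∀ d, g d ≠ 0 := by
  classical
  have hsub : Finset.univ.erase (0 : A) ⊆ Finset.univ.image g := fun x hx => by
    obtain ⟨d, hd⟩ := hg x (Finset.ne_of_mem_erase hx)
    exact Finset.mem_image.2 ⟨d, Finset.mem_univ d, hd⟩
  have herase : (Finset.univ.erase (0 : A)).card = Fintype.card D := by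
    rw [Finset.card_erase_of_mem (Finset.mem_univ _), Finset.card_univ]
    omega
  have heq := Finset.eq_of_subset_of_card_le hsub (herase ▸ Finset.card_image_le)
  constructor
  · have hc : (Finset.univ.image g).card = (Finset.univ : Finset D).card := by
      rw [← heq, herase, Finset.card_univ]
    simpa [Set.injOn_univ] using Finset.card_image_iff.1 hc
  · intro d
    exact Finset.ne_of_mem_erase (heq ▸ Finset.mem_image_of_mem g (Finset.mem_univ d))

/-- Every element of `ZMod n` with `n` odd is plus or minus a natural number at most `n / 2`. -/
theorem ZMod.exists_eq_or_eq_neg {n k : ℕ} (hn : n = 2 * k + 1) {x : ZMod n} (hx : x ≠ 0) :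
    ∃ a : ℕ, 1 ≤ a ∧ a ≤ k ∧ (x = a ∨ x = -a) := by
  subst hn
  have hlt := x.val_lt
  have hpos : x.val ≠ 0 := (ZMod.val_eq_zero x).not.2 hx
  rcases le_or_gt x.val k with h | h
  · exact ⟨x.val, by omega, h, Or.inl (by simp)⟩
  · refine ⟨2 * k + 1 - x.val, by omega, by omega, Or.inr ?_⟩
    rw [Nat.cast_sub hlt.le, ZMod.natCast_self, ZMod.natCast_zmod_val]
    simp

open LadderDart in
/-- Two ladders whose currents exhaust the nonzero elements of a cyclic group yield a triangular
biembedding of the complete graph. -/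
theorem exists_biembedding_of_currents {A : Type*} [AddCommGroup A] [Fintype A] {m₁ m₂ : ℕ}
    (hm₁ : Even m₁) (hm₂ : Even m₂) (hcard : 6 * m₁ + 6 + (6 * m₂ + 6) + 1 = Fintype.card A)
    (h₁ : Fin (m₁ + 1) → A) (c₁ : A) (h₂ : Fin (m₂ + 1) → A) (c₂ : A)
    (hcover : ∀ x ≠ 0, (∃ d, current h₁ c₁ d = x) ∨ ∃ d, current h₂ c₂ d = x) :
    ∃ G₁ G₂ : SimpleGraph A, G₁ ⊔ G₂ = ⊤ ∧ G₁ ⊓ G₂ = ⊥ ∧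
      (∃ R₁ : RotationSystem G₁, R₁.Triangular) ∧
      (∃ R₂ : RotationSystem G₂, R₂.Triangular) := by
  obtain ⟨hinj, hne⟩ := injective_and_ne_zero_of_card
    (g := Sum.elim (current h₁ c₁) (current h₂ c₂))
    (by rw [Fintype.card_sum, card_eq, card_eq, hcard]) (fun x hx => by simpa using hcover x hx)
  have hinj₁ : Injective (current h₁ c₁) := hinj.comp Sum.inl_injective
  have hinj₂ : Injective (current h₂ c₂) := hinj.comp Sum.inr_injective
  have hne₁ : ∀ d, current h₁ c₁ d ≠ 0 := fun d => hne (.inl d)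
  have hne₂ : ∀ d, current h₂ c₂ d ≠ 0 := fun d => hne (.inr d)
  have hadj : ∀ {m : ℕ} (h : Fin (m + 1) → A) (c : A), (∀ d, current h c d ≠ 0) → ∀ u v,
      (SimpleGraph.circulantGraph (Set.range (current h c))).Adj u v ↔
        ∃ d, current h c d = v - u := fun h c h0 u v =>
    circulantGraph_adj_iff (by rintro ⟨d, hd⟩; exact h0 d hd) (by
      rintro _ ⟨d, rfl⟩
      exact exists_current_eq_neg h c d)
  refine ⟨_, _, ?_, ?_,
    exists_triangular_circulantGraph hinj₁ hne₁ (current_next h₁ c₁) (exists_iterate_next_eq hm₁),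
    exists_triangular_circulantGraph hinj₂ hne₂ (current_next h₂ c₂) (exists_iterate_next_eq hm₂)⟩
  · ext u v
    rw [SimpleGraph.sup_adj, hadj h₁ c₁ hne₁, hadj h₂ c₂ hne₂, SimpleGraph.top_adj]
    refine ⟨?_, fun huv => hcover _ (sub_ne_zero.2 huv.symm)⟩
    rintro (⟨d, hd⟩ | ⟨d, hd⟩) rfl
    · exact hne₁ d (by rw [hd, sub_self])
    · exact hne₂ d (by rw [hd, sub_self])
  · ext u v
    rw [SimpleGraph.inf_adj, hadj h₁ c₁ hne₁, hadj h₂ c₂ hne₂, SimpleGraph.bot_adj, iff_false]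
    rintro ⟨⟨d, hd⟩, e, he⟩
    exact Sum.inl_ne_inr (hinj (a₁ := .inl d) (a₂ := .inr e) (hd.trans he.symm))

/-- The currents on the top rails of a ladder with `2 * t` rungs: a zigzag preceded by two
exceptional values. -/
def railCurrent (t i : ℕ) : ℤ :=
  if t = 0 then 4
  else if i = 0 then 5 * t + 5
  else if i = 1 then 2 * t + 2
  else if i % 2 = 0 then (i / 2 : ℕ) - 3 * t - 3
  else -(i / 2 : ℕ) - 3 * t - 4

open LadderDart in
/-- Up to sign, the ladder with rail currents `railCurrent t` and arc current `2 * t + 1` covers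
`1, …, 6 * t + 4` except `2`. -/
theorem exists_current_railCurrent_eq (t a : ℕ) (ha : 1 ≤ a) (ha' : a ≤ 6 * t + 4) (ha₂ : a ≠ 2) :
    ∃ d, current (fun i : Fin (2 * t + 1) => railCurrent t i) (2 * t + 1) d = a ∨
      current (fun i : Fin (2 * t + 1) => railCurrent t i) (2 * t + 1) d = -a := by
  have top : ∀ i ≤ 2 * t, railCurrent t i = a ∨ railCurrent t i = -a →
      ∃ d, current (fun i : Fin (2 * t + 1) => railCurrent t i) (2 * t + 1) d = a ∨
        current (fun i : Fin (2 * t + 1) => railCurrent t i) (2 * t + 1) d = -a :=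
    fun i hi h => ⟨topPos ⟨i, by omega⟩, h⟩
  have bot : ∀ i ≤ 2 * t, 2 * t + 1 - railCurrent t i = a ∨ 2 * t + 1 - railCurrent t i = -a →
      ∃ d, current (fun i : Fin (2 * t + 1) => railCurrent t i) (2 * t + 1) d = a ∨
        current (fun i : Fin (2 * t + 1) => railCurrent t i) (2 * t + 1) d = -a :=
    fun i hi h => ⟨botPos ⟨i, by omega⟩, h⟩
  have rung : ∀ i < 2 * t, railCurrent t (i + 1) - railCurrent t i = a ∨
      railCurrent t (i + 1) - railCurrent t i = -a →
      ∃ d, current (fun i : Fin (2 * t + 1) => railCurrent t i) (2 * t + 1) d = a ∨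
        current (fun i : Fin (2 * t + 1) => railCurrent t i) (2 * t + 1) d = -a :=
    fun i hi h => ⟨rungPos ⟨i, hi⟩, h⟩
  rcases Nat.eq_zero_or_pos t with rfl | ht
  · obtain rfl | rfl | rfl : a = 1 ∨ a = 3 ∨ a = 4 := by omega
    · exact ⟨arcPos, by simp [current]⟩
    · exact bot 0 le_rfl (by simp [railCurrent])
    · exact top 0 le_rfl (by simp [railCurrent])
  have h₀ : railCurrent t 0 = 5 * t + 5 := by simp [railCurrent, ht.ne']
  have h₁ : railCurrent t 1 = 2 * t + 2 := by simp [railCurrent, ht.ne']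
  have hEven : ∀ j : ℕ, railCurrent t (2 * j + 2) = j - 3 * t - 2 := fun j => by
    rw [railCurrent, if_neg ht.ne', if_neg (by omega), if_neg (by omega), if_pos (by omega)]
    omega
  have hOdd : ∀ j : ℕ, railCurrent t (2 * j + 3) = -j - 3 * t - 5 := fun j => by
    rw [railCurrent, if_neg ht.ne', if_neg (by omega), if_neg (by omega), if_neg (by omega)]
    omega
  have h₂ : railCurrent t 2 = _ := hEven 0
  rcases lt_or_ge a 3 with h | h
  · exact bot 1 (by omega) (by omega)
  rcases lt_or_ge a (2 * t + 1) with h | h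
  · obtain ⟨j, rfl | rfl⟩ : ∃ j, a = 2 * j + 3 ∨ a = 2 * j + 4 := ⟨(a - 3) / 2, by omega⟩
    · have := hEven j
      have : railCurrent t (2 * j + 2 + 1) = _ := hOdd j
      exact rung (2 * j + 2) (by omega) (by omega)
    · have := hOdd j
      have : railCurrent t (2 * j + 3 + 1) = _ := hEven (j + 1)
      exact rung (2 * j + 3) (by omega) (by omega)
  rcases eq_or_lt_of_le h with rfl | h
  · exact ⟨arcPos, Or.inl (by simp [current])⟩
  rcases lt_or_ge a (2 * t + 3) with h | h
  · exact top 1 (by omega) (by omega)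
  rcases lt_or_ge a (3 * t + 3) with h | h
  · exact top (2 * (3 * t + 2 - a) + 2) (by omega) (by rw [hEven]; omega)
  rcases lt_or_ge a (3 * t + 4) with h | h
  · exact rung 0 (by omega) (by rw [zero_add]; omega)
  rcases lt_or_ge a (3 * t + 5) with h | h
  · exact bot 0 (by omega) (by omega)
  rcases lt_or_ge a (4 * t + 4) with h | h
  · exact top (2 * (a - 3 * t - 5) + 3) (by omega) (by rw [hOdd]; omega)
  rcases lt_or_ge a (5 * t + 4) with h | h
  · exact bot (2 * (5 * t + 3 - a) + 2) (by omega) (by rw [hEven]; omega)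
  rcases lt_or_ge a (5 * t + 5) with h | h
  · exact rung 1 (by omega) (by rw [one_add_one_eq_two]; omega)
  rcases lt_or_ge a (5 * t + 6) with h | h
  · exact top 0 (by omega) (by omega)
  · exact bot (2 * (a - 5 * t - 6) + 3) (by omega) (by rw [hOdd]; omega)

open LadderDart in
/-- The complete graph on `12 * t + 13` vertices has a triangular biembedding. -/
theorem exists_biembedding_zmod (t n : ℕ) (hn : n = 12 * t + 13) :
    ∃ G₁ G₂ : SimpleGraph (ZMod n), G₁ ⊔ G₂ = ⊤ ∧ G₁ ⊓ G₂ = ⊥ ∧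
      (∃ R₁ : RotationSystem G₁, R₁.Triangular) ∧
      (∃ R₂ : RotationSystem G₂, R₂.Triangular) := by
  have : NeZero n := ⟨by omega⟩
  have hzero : ((12 * t + 13 : ℕ) : ZMod n) = 0 := hn ▸ ZMod.natCast_self n
  refine exists_biembedding_of_currents (m₁ := 2 * t) (m₂ := 0) (even_two_mul t) Even.zero
    (by rw [ZMod.card]; omega)
    (fun i => ((railCurrent t i : ℤ) : ZMod n)) ((2 * t + 1 : ℤ) : ZMod n)
    (fun _ => 2) (-(6 * t + 5)) fun x hx => ?_
  obtain ⟨a, ha, ha', hxa⟩ := ZMod.exists_eq_or_eq_neg (k := 6 * t + 6) (by omega) hx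
  have lift : ∀ {m : ℕ} {h : Fin (m + 1) → ZMod n} {c : ZMod n},
      (∃ d, current h c d = a ∨ current h c d = -a) → ∃ d, current h c d = x := by
    rintro m h c ⟨d, hd⟩
    obtain ⟨e, he⟩ := exists_current_eq_neg h c d
    rcases hxa with rfl | rfl <;> rcases hd with hd | hd
    · exact ⟨d, hd⟩
    · exact ⟨e, by rw [he, hd, neg_neg]⟩
    · exact ⟨e, by rw [he, hd]⟩
    · exact ⟨d, hd⟩
  by_cases h₂ : a = 2
  · exact Or.inr (lift ⟨topPos 0, Or.inl (by simp [current, h₂])⟩)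
  by_cases h₅ : a = 6 * t + 5
  · exact Or.inr (lift ⟨arcPos, Or.inr (by simp [current, h₅])⟩)
  by_cases h₆ : a = 6 * t + 6
  · refine Or.inr (lift ⟨botPos 0, Or.inl ?_⟩)
    subst h₆
    push_cast at hzero
    push_cast [current]
    linear_combination -hzero
  · refine Or.inl (lift ?_)
    obtain ⟨d, hd⟩ := exists_current_railCurrent_eq t a ha (by omega) h₂
    refine ⟨d, ?_⟩
    have hmap := current_map (Int.castAddHom (ZMod n))
      (fun i : Fin (2 * t + 1) => railCurrent t i) (2 * t + 1) d
    simp only [Int.coe_castAddHom] at hmap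
    rw [hmap]
    exact hd.imp (fun h => by rw [h, Int.cast_natCast])
      (fun h => by rw [h, Int.cast_neg, Int.cast_natCast])

/-- For every integer `s ≥ 0`, the complete graph `K_{24s+13}` admits a triangular biembedding:
two spanning subgraphs whose edge sets partition the edges of the complete graph, each admitting
a triangular rotation system. -/
theorem complete_graph_triangular_biembedding (s : ℕ) :
    ∃ G₁ G₂ : SimpleGraph (Fin (24 * s + 13)),
      G₁ ⊔ G₂ = ⊤ ∧ G₁ ⊓ G₂ = ⊥ ∧
      (∃ R₁ : RotationSystem G₁, R₁.Triangular) ∧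
      (∃ R₂ : RotationSystem G₂, R₂.Triangular) := by
  exact exists_biembedding_zmod (2 * s) (24 * s + 13) (by omega)
end

section
/- For every integer s ≥ 1, let n = 24s+13, let X₁ = {1, 6} ∪ { i : 1 ≤ i ≤ 12s+6, i mod 6 ∈ {2,3,5}, i ∉ {6s+2, 12s+5} }, and let X₂ = {1, …, 12s+6} \ X₁. Then |X₁| = |X₂| = 6s+3, the edge sets of the circulant graphs C(n, X₁) and C(n, X₂) partition the edge set of the complete graph on ℤ/nℤ, and each of C(n, X₁) and C(n, X₂) admits a triangular rotation system. -/
/-- The label set of the first current graph in the main construction: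
`X₁ = {1, 6} ∪ { i : 1 ≤ i ≤ 12s+6, i mod 6 ∈ {2,3,5}, i ∉ {6s+2, 12s+5} }`. -/
def mainX₁ (s : ℕ) : Finset ℕ :=
  {1, 6} ∪ ((Finset.Icc 1 (12 * s + 6)).filter
    (fun i => (i % 6 = 2 ∨ i % 6 = 3 ∨ i % 6 = 5) ∧ i ≠ 6 * s + 2 ∧ i ≠ 12 * s + 5))

/-- The label set of the second current graph: `X₂ = {1, …, 12s+6} \ X₁`. -/
def mainX₂ (s : ℕ) : Finset ℕ := Finset.Icc 1 (12 * s + 6) \ mainX₁ s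

/-- The entries of a list of triples. -/
def tripleLabels {α : Type*} (L : List (α × α × α)) : List α :=
  L.flatMap fun t => [t.1, t.2.1, t.2.2]

/-- The steps `a → -b`, `b → -c`, `c → -a` of the triples `(a, b, c)` of a list. These are the
steps from a label to the next one in the face boundary of the current graph whose vertices
are the triples. -/
def tripleSteps {α : Type*} [Neg α] (L : List (α × α × α)) : List (α × α) :=
  L.flatMap fun t => [(t.1, -t.2.1), (t.2.1, -t.2.2), (t.2.2, -t.1)]

/-- The steps of the triples lead from some entry to all entries. -/
def StepConnected (L : List (ℤ × ℤ × ℤ)) : Prop :=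
  ∃ b ∈ tripleLabels L, ∀ P : ℤ → Prop, (∀ p ∈ tripleSteps L, P p.1 → P p.2) → P b →
    ∀ d ∈ tripleLabels L, P d

/-- In a list of triples with distinct entries, every entry has a unique cyclic successor, and
the successor map has order three. -/
theorem exists_rotate {L : List (ℤ × ℤ × ℤ)} (hL : (tripleLabels L).Nodup) :
    ∃ φ : ℤ → ℤ, ∀ t ∈ L, φ t.1 = t.2.1 ∧ φ t.2.1 = t.2.2 ∧ φ t.2.2 = t.1 := by
  induction L with
  | nil => exact ⟨id, by simp⟩
  | cons t L ih =>
    obtain ⟨a, b, c⟩ := t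
    have hsplit : tripleLabels ((a, b, c) :: L) = a :: b :: c :: tripleLabels L := rfl
    rw [hsplit] at hL
    simp only [List.nodup_cons, List.mem_cons, not_or] at hL
    obtain ⟨⟨hab, hac, ha⟩, ⟨hbc, hb⟩, hc, hL⟩ := hL
    obtain ⟨φ, hφ⟩ := ih hL
    refine ⟨fun x => if x = a then b else if x = b then c else if x = c then a else φ x, ?_⟩
    intro t ht
    rcases List.mem_cons.1 ht with rfl | ht
    · simp [Ne.symm hab, Ne.symm hac, Ne.symm hbc]
    · have key : ∀ x ∈ [t.1, t.2.1, t.2.2], x ≠ a ∧ x ≠ b ∧ x ≠ c := by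
        intro x hx
        have : x ∈ tripleLabels L := List.mem_flatMap.2 ⟨t, ht, hx⟩
        refine ⟨?_, ?_, ?_⟩ <;> rintro rfl <;> contradiction
      obtain ⟨h1, h2, h3⟩ := hφ t ht
      have k1 := key t.1 (by simp)
      have k2 := key t.2.1 (by simp)
      have k3 := key t.2.2 (by simp)
      simp [k1, k2, k3, h1, h2, h3]

/-- A regular embedding of a Cayley graph of an abelian group: a permutation of the connection
set that acts as a single cycle and satisfies the triangle condition at every element yields a
triangular rotation system. -/
theorem exists_triangular_of_perm {A : Type*} [AddCommGroup A] (G : SimpleGraph A) (D : Set A)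
    (hadj : ∀ v u, G.Adj v u ↔ u - v ∈ D) (σ : Equiv.Perm A) (hmem : ∀ d ∈ D, σ d ∈ D)
    (hfix : ∀ d, d ∉ D → σ d = d) (hcyc : ∀ d ∈ D, ∀ e ∈ D, ∃ k : ℕ, (σ ^ k) d = e)
    (htri : ∀ d ∈ D, σ (-σ d) = d - σ d) :
    ∃ R : RotationSystem G, R.Triangular := by
  have hneg : ∀ d ∈ D, -d ∈ D := by
    intro d hd
    have h : G.Adj 0 d := (hadj _ _).2 (by simpa using hd)
    simpa using (hadj _ _).1 h.symm
  let ρ : A → Equiv.Perm A := fun v => ((Equiv.subRight v).trans σ).trans (Equiv.addRight v)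
  have hρ : ∀ v u, ρ v u = σ (u - v) + v := fun v u => rfl
  have hpow : ∀ (v : A) (k : ℕ) (u : A), ((ρ v) ^ k) u = (σ ^ k) (u - v) + v := by
    intro v k
    induction k with
    | zero => simp
    | succ k ih =>
      intro u
      rw [pow_succ', Equiv.Perm.mul_apply, ih, hρ, pow_succ', Equiv.Perm.mul_apply]
      simp
  let R : RotationSystem G :=
    { ρ := ρ
      mem_neighbor := fun v u h => by
        rw [hadj] at h ⊢
        simpa [hρ] using hmem _ h
      fixes := fun v u h => by
        rw [hadj] at h
        simp [hρ, hfix _ h]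
      single_cycle := fun v u w hu hw => by
        rw [hadj] at hu hw
        obtain ⟨k, hk⟩ := hcyc _ hu _ hw
        exact ⟨k, by simp [hpow, hk]⟩ }
  refine ⟨R, fun d => ?_⟩
  have h3 : Function.IsPeriodicPt R.facePerm 3 d := by
    obtain ⟨⟨u, v⟩, huv⟩ := d
    have hd : u - v ∈ D := (hadj _ _).1 huv.symm
    have e1 := htri _ hd
    have e2 := htri _ (hneg _ (hmem _ hd))
    rw [e1] at e2
    have s1 : R.ρ v u = σ (u - v) + v := rfl
    have s2 : R.ρ (R.ρ v u) v = u := by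
      rw [s1]
      change σ (v - (σ (u - v) + v)) + (σ (u - v) + v) = u
      rw [show v - (σ (u - v) + v) = -σ (u - v) by abel, e1]
      abel
    have s3 : R.ρ u (R.ρ v u) = v := by
      rw [s1]
      change σ (σ (u - v) + v - u) + u = v
      rw [show σ (u - v) + v - u = -(u - v - σ (u - v)) by abel, e2]
      abel
    apply SimpleGraph.Dart.ext
    simp only [Function.iterate_succ, Function.iterate_zero, Function.comp_apply, id_eq,
      RotationSystem.facePerm]
    rw [s2, s3]
  have h1 : Function.minimalPeriod R.facePerm d ≠ 1 := by
    rw [Ne, Function.minimalPeriod_eq_one_iff_isFixedPt]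
    intro h
    have : d.snd = d.fst := congrArg (fun e : G.Dart => e.fst) h
    exact d.fst_ne_snd this.symm
  exact ((Nat.dvd_prime Nat.prime_three).1 h3.minimalPeriod_dvd).resolve_left h1

theorem circulant_adj {n : ℕ} [NeZero n] {X : Finset ℕ} (hX : ∀ x ∈ X, 1 ≤ x ∧ x ≤ n / 2)
    (i j : ZMod n) :
    (circulant n ↑X).Adj i j ↔ (j - i).valMinAbs.natAbs ∈ X := by
  have key : ∀ a : ZMod n, (∃ x ∈ (X : Set ℕ), a = (x : ZMod n)) → a.valMinAbs.natAbs ∈ X := by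
    rintro a ⟨x, hx, rfl⟩
    rw [ZMod.valMinAbs_natCast_of_le_half (hX x hx).2]
    simpa using hx
  rw [circulant, SimpleGraph.fromRel_adj]
  constructor
  · rintro ⟨-, h | h⟩
    · rw [← ZMod.natAbs_valMinAbs_neg, neg_sub]
      exact key _ h
    · exact key _ h
  · intro h
    refine ⟨?_, ?_⟩
    · rintro rfl
      have := hX _ h
      simp at this
    · have e : (((j - i).valMinAbs : ℤ) : ZMod n) = j - i := ZMod.coe_valMinAbs _
      rcases Int.natAbs_eq (j - i).valMinAbs with h' | h'
      · refine Or.inr ⟨_, h, ?_⟩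
        rw [← e]
        conv_lhs => rw [h']
        simp
      · refine Or.inl ⟨_, h, ?_⟩
        rw [← neg_sub, ← e]
        conv_lhs => rw [h']
        simp

/-- A list of zero-sum triples that partitions the signed labels and whose steps are connected
yields a triangular rotation system of the circulant graph. -/
theorem exists_triangular_of_triples {n : ℕ} (hn : Odd n) {X : Finset ℕ}
    (hX : ∀ x ∈ X, 1 ≤ x ∧ x ≤ n / 2) (L : List (ℤ × ℤ × ℤ)) (hlen : 3 * L.length ≤ 2 * X.card)
    (hcov : ∀ x ∈ X, (x : ℤ) ∈ tripleLabels L ∧ -(x : ℤ) ∈ tripleLabels L)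
    (hsum : ∀ t ∈ L, (n : ℤ) ∣ t.1 + t.2.1 + t.2.2) (hconn : StepConnected L) :
    ∃ R : RotationSystem (circulant n ↑X), R.Triangular := by
  have : NeZero n := ⟨hn.pos.ne'⟩
  have hlen' : (tripleLabels L).length = 3 * L.length := by
    clear * -
    induction L with
    | nil => rfl
    | cons t L ih =>
      rw [tripleLabels, List.flatMap_cons, List.length_append, ← tripleLabels, ih]
      simp
      ring
  let pos : Finset ℤ := X.map Nat.castEmbedding
  let neg : Finset ℤ := X.map (Nat.castEmbedding.trans (Equiv.neg ℤ).toEmbedding)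
  have hdisj : Disjoint pos neg := by
    rw [Finset.disjoint_left]
    simp only [pos, neg, Finset.mem_map]
    rintro _ ⟨x, hx, rfl⟩ ⟨y, hy, h⟩
    have h1 := hX x hx
    have h2 := hX y hy
    simp at h
    omega
  have hsub : pos ∪ neg ⊆ (tripleLabels L).toFinset := by
    intro d hd
    simp only [pos, neg, Finset.mem_union, Finset.mem_map] at hd
    rw [List.mem_toFinset]
    rcases hd with ⟨x, hx, rfl⟩ | ⟨x, hx, rfl⟩
    · exact (hcov x hx).1
    · exact (hcov x hx).2
  have hcard : (pos ∪ neg).card = 2 * X.card := by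
    rw [Finset.card_union_of_disjoint hdisj, Finset.card_map, Finset.card_map, two_mul]
  have hle : (tripleLabels L).toFinset.card ≤ (tripleLabels L).length := List.toFinset_card_le _
  have heq : pos ∪ neg = (tripleLabels L).toFinset :=
    Finset.eq_of_subset_of_card_le hsub (by omega)
  have hnodup : (tripleLabels L).Nodup := by
    have : (tripleLabels L).toFinset.card = (tripleLabels L).length := by
      have := Finset.card_le_card hsub
      omega
    exact Multiset.toFinset_card_eq_card_iff_nodup.1 this
  have hlab : ∀ d, d ∈ tripleLabels L ↔ d.natAbs ∈ X := by
    intro d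
    rw [← List.mem_toFinset, ← heq]
    simp only [pos, neg, Finset.mem_union, Finset.mem_map]
    constructor
    · rintro (⟨x, hx, rfl⟩ | ⟨x, hx, rfl⟩) <;> simpa using hx
    · intro h
      rcases Int.natAbs_eq d with h' | h'
      · exact Or.inl ⟨_, h, h'.symm⟩
      · exact Or.inr ⟨_, h, h'.symm⟩
  obtain ⟨φ, hφ⟩ := exists_rotate hnodup
  have hφ' : ∀ d ∈ tripleLabels L, φ d ∈ tripleLabels L ∧ φ (φ d) ∈ tripleLabels L ∧
      φ (φ (φ d)) = d ∧ (n : ℤ) ∣ d + φ d + φ (φ d) := by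
    intro d hd
    obtain ⟨t, ht, hd⟩ := List.mem_flatMap.1 hd
    obtain ⟨h1, h2, h3⟩ := hφ t ht
    have hm : ∀ x ∈ [t.1, t.2.1, t.2.2], x ∈ tripleLabels L :=
      fun x hx => List.mem_flatMap.2 ⟨t, ht, hx⟩
    have m1 := hm t.1 (by simp)
    have m2 := hm t.2.1 (by simp)
    have m3 := hm t.2.2 (by simp)
    have hs := hsum t ht
    simp only [List.mem_cons, List.not_mem_nil, or_false] at hd
    rcases hd with rfl | rfl | rfl
    · simp [h1, h2, h3, m2, m3, hs]
    · refine ⟨by rwa [h2], by rwa [h2, h3], by rw [h2, h3, h1], ?_⟩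
      rw [h2, h3]
      convert hs using 1
      ring
    · refine ⟨by rwa [h3], by rwa [h3, h1], by rw [h3, h1, h2], ?_⟩
      rw [h3, h1]
      convert hs using 1
      ring
  have hlift : ∀ d ∈ tripleLabels L, ((d : ZMod n)).valMinAbs = d := by
    intro d hd
    have h1 := hX _ ((hlab d).1 hd)
    obtain ⟨k, hk⟩ := hn
    rw [ZMod.valMinAbs_spec]
    refine ⟨rfl, ?_, ?_⟩ <;> omega
  let D : Set (ZMod n) := {a | a.valMinAbs ∈ tripleLabels L}
  have hD : ∀ d ∈ tripleLabels L, (d : ZMod n) ∈ D := by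
    intro d hd
    change ((d : ZMod n)).valMinAbs ∈ tripleLabels L
    rwa [hlift d hd]
  have hneg : ∀ d ∈ tripleLabels L, -d ∈ tripleLabels L := by
    intro d hd
    rw [hlab] at hd ⊢
    simpa using hd
  classical
  let f : ZMod n → ZMod n := fun a => if a ∈ D then ((-φ a.valMinAbs : ℤ) : ZMod n) else a
  have hf : ∀ d ∈ tripleLabels L, f (d : ZMod n) = ((-φ d : ℤ) : ZMod n) := by
    intro d hd
    simp only [f, if_pos (hD d hd), hlift d hd]
  have hrep : ∀ a ∈ D, ∃ d ∈ tripleLabels L, (d : ZMod n) = a :=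
    fun a ha => ⟨a.valMinAbs, ha, ZMod.coe_valMinAbs a⟩
  have hfD : ∀ a ∈ D, f a ∈ D := by
    intro a ha
    obtain ⟨d, hd, rfl⟩ := hrep a ha
    rw [hf d hd]
    exact hD _ (hneg _ (hφ' d hd).1)
  have hf' : ∀ a, a ∉ D → f a = a := fun a ha => if_neg ha
  have hinj : Function.Injective f := by
    intro a b hab
    by_cases ha : a ∈ D
    · by_cases hb : b ∈ D
      · obtain ⟨d, hd, rfl⟩ := hrep a ha
        obtain ⟨e, he, rfl⟩ := hrep b hb
        rw [hf d hd, hf e he] at hab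
        have h := congrArg ZMod.valMinAbs hab
        rw [hlift _ (hneg _ (hφ' d hd).1), hlift _ (hneg _ (hφ' e he).1)] at h
        rw [← (hφ' d hd).2.2.1, ← (hφ' e he).2.2.1, neg_injective h]
      · rw [hf' b hb] at hab
        exact absurd (hab ▸ hfD a ha) hb
    · by_cases hb : b ∈ D
      · rw [hf' a ha] at hab
        exact absurd (hab ▸ hfD b hb) ha
      · rwa [hf' a ha, hf' b hb] at hab
  let σ : Equiv.Perm (ZMod n) := Equiv.ofBijective f (Finite.injective_iff_bijective.1 hinj)
  have hσ : ∀ a, σ a = f a := fun a => rfl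
  obtain ⟨b, hb, hconn⟩ := hconn
  have hreach : ∀ d ∈ tripleLabels L, σ.SameCycle (b : ZMod n) (d : ZMod n) := by
    refine hconn (fun d => σ.SameCycle (b : ZMod n) (d : ZMod n)) ?_ (Equiv.Perm.SameCycle.refl _ _)
    have step : ∀ d ∈ tripleLabels L, ∀ e, φ d = e → σ.SameCycle (b : ZMod n) (d : ZMod n) →
        σ.SameCycle (b : ZMod n) ((-e : ℤ) : ZMod n) := by
      rintro d hd _ rfl h
      have h' := Equiv.Perm.sameCycle_apply_right.2 h
      rwa [hσ, hf d hd] at h'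
    intro p hp
    obtain ⟨t, ht, hp⟩ := List.mem_flatMap.1 hp
    obtain ⟨h1, h2, h3⟩ := hφ t ht
    have hm : ∀ x ∈ [t.1, t.2.1, t.2.2], x ∈ tripleLabels L :=
      fun x hx => List.mem_flatMap.2 ⟨t, ht, hx⟩
    simp only [List.mem_cons, List.not_mem_nil, or_false] at hp
    rcases hp with rfl | rfl | rfl
    · exact step _ (hm _ (by simp)) _ h1
    · exact step _ (hm _ (by simp)) _ h2
    · exact step _ (hm _ (by simp)) _ h3
  refine exists_triangular_of_perm _ D (fun v u => ?_) σ hfD hf' ?_ ?_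
  · rw [circulant_adj hX, ← hlab]
    rfl
  · intro a ha e he
    obtain ⟨c, hc, rfl⟩ := hrep a ha
    obtain ⟨d, hd, rfl⟩ := hrep e he
    obtain ⟨k, -, hk⟩ := ((hreach c hc).symm.trans (hreach d hd)).exists_pow_eq'
    exact ⟨k, hk⟩
  · intro a ha
    obtain ⟨d, hd, rfl⟩ := hrep a ha
    obtain ⟨m1, -, -, hs⟩ := hφ' d hd
    rw [hσ, hσ, hf d hd, Int.cast_neg, neg_neg, hf _ m1]
    have h := (ZMod.intCast_zmod_eq_zero_iff_dvd _ n).2 hs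
    push_cast at h ⊢
    linear_combination -h

/-- The value at `m` of the affine function with coefficients `p`. -/
def affineEval (m : ℤ) (p : ℤ × ℤ) : ℤ := p.1 * m + p.2

/-- The triple of values at `m` of a triple of affine functions. -/
def affineTriple (m : ℤ) (t : (ℤ × ℤ) × (ℤ × ℤ) × (ℤ × ℤ)) : ℤ × ℤ × ℤ :=
  (affineEval m t.1, affineEval m t.2.1, affineEval m t.2.2)

/-- The vertices of a ladder with `2m` rungs. The horizontal currents along one side are
`t 0, u 0, t 1, u 1, …, t m`, those along the other side are `b 0, v 0, b 1, v 1, …, b m`. -/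
def ladderTriples (t u b v : ℕ → ℤ) (m : ℕ) : List (ℤ × ℤ × ℤ) :=
  (List.range m).flatMap fun i =>
    [(t i, u i - t i, -u i), (b i, t i - u i, -v i),
      (u i, t (i + 1) - u i, -t (i + 1)), (v i, u i - t (i + 1), -b (i + 1))]

theorem length_ladderTriples (t u b v : ℕ → ℤ) (m : ℕ) :
    (ladderTriples t u b v m).length = 4 * m := by
  simp [ladderTriples, mul_comm]

theorem affineEval_neg (m : ℤ) (p : ℤ × ℤ) : affineEval m (-p) = -affineEval m p := by
  simp only [affineEval, Prod.fst_neg, Prod.snd_neg]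
  ring

theorem tripleLabels_append {α : Type*} (L M : List (α × α × α)) :
    tripleLabels (L ++ M) = tripleLabels L ++ tripleLabels M :=
  List.flatMap_append

theorem tripleSteps_append {α : Type*} [Neg α] (L M : List (α × α × α)) :
    tripleSteps (L ++ M) = tripleSteps L ++ tripleSteps M :=
  List.flatMap_append

theorem tripleLabels_map_affineTriple (m : ℤ) (E : List ((ℤ × ℤ) × (ℤ × ℤ) × (ℤ × ℤ))) :
    tripleLabels (E.map (affineTriple m)) = (tripleLabels E).map (affineEval m) := by
  simp [tripleLabels, List.flatMap_map, List.map_flatMap, affineTriple]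

theorem tripleSteps_map_affineTriple (m : ℤ) (E : List ((ℤ × ℤ) × (ℤ × ℤ) × (ℤ × ℤ))) :
    tripleSteps (E.map (affineTriple m)) =
      (tripleSteps E).map (Prod.map (affineEval m) (affineEval m)) := by
  simp [tripleSteps, List.flatMap_map, List.map_flatMap, affineTriple, affineEval_neg]

/-- A property that is preserved along the steps of a ladder passes from each of its four
entrances to the opposite exit, and from all four entrances to the whole ladder. -/
theorem ladder_steps {t u b v : ℕ → ℤ} {m : ℕ} {P : ℤ → Prop}
    (hP : ∀ p ∈ tripleSteps (ladderTriples t u b v m), P p.1 → P p.2) :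
    (P (t 0) → P (t m)) ∧ (P (b 0) → P (b m)) ∧ (P (-t m) → P (-t 0)) ∧ (P (-b m) → P (-b 0)) ∧
      (P (t 0) → P (b 0) → P (-t m) → P (-b m) →
        ∀ d ∈ tripleLabels (ladderTriples t u b v m), P d) := by
  have step : ∀ i < m, ∀ x y z,
      (x, y, z) ∈ [(t i, u i - t i, -u i), (b i, t i - u i, -v i),
        (u i, t (i + 1) - u i, -t (i + 1)), (v i, u i - t (i + 1), -b (i + 1))] →
      (P x → P (-y)) ∧ (P y → P (-z)) ∧ (P z → P (-x)) := by
    intro i hi x y z h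
    have hmem : (x, y, z) ∈ ladderTriples t u b v m :=
      List.mem_flatMap.2 ⟨i, List.mem_range.2 hi, h⟩
    refine ⟨hP (x, -y) ?_, hP (y, -z) ?_, hP (z, -x) ?_⟩ <;>
      exact List.mem_flatMap.2 ⟨_, hmem, by simp⟩
  have key : ∀ i < m,
      ((P (t i) → P (t i - u i)) ∧ (P (u i - t i) → P (u i)) ∧ (P (-u i) → P (-t i))) ∧
      ((P (b i) → P (u i - t i)) ∧ (P (t i - u i) → P (v i)) ∧ (P (-v i) → P (-b i))) ∧
      ((P (u i) → P (u i - t (i + 1))) ∧ (P (t (i + 1) - u i) → P (t (i + 1))) ∧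
        (P (-t (i + 1)) → P (-u i))) ∧
      ((P (v i) → P (t (i + 1) - u i)) ∧ (P (u i - t (i + 1)) → P (b (i + 1))) ∧
        (P (-b (i + 1)) → P (-v i))) := by
    intro i hi
    have h1 := step i hi _ _ _ (List.mem_cons_self ..)
    have h2 := step i hi _ _ _ (List.mem_cons_of_mem _ (List.mem_cons_self ..))
    have h3 := step i hi _ _ _
      (List.mem_cons_of_mem _ (List.mem_cons_of_mem _ (List.mem_cons_self ..)))
    have h4 := step i hi _ _ _ (List.mem_cons_of_mem _
      (List.mem_cons_of_mem _ (List.mem_cons_of_mem _ (List.mem_cons_self ..))))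
    rw [neg_sub, neg_neg] at h1 h2 h3 h4
    exact ⟨h1, h2, h3, h4⟩
  have up : ∀ i ≤ m, (P (t 0) → P (t i)) ∧ (P (b 0) → P (b i)) := by
    intro i
    induction i with
    | zero => simp
    | succ i ih =>
      intro hi
      obtain ⟨ih₁, ih₂⟩ := ih (by omega)
      obtain ⟨k1, k2, k3, k4⟩ := key i (by omega)
      exact ⟨fun h => k3.2.1 (k4.1 (k2.2.1 (k1.1 (ih₁ h)))),
        fun h => k4.2.1 (k3.1 (k1.2.1 (k2.1 (ih₂ h))))⟩
  have down : ∀ k ≤ m, (P (-t m) → P (-t (m - k))) ∧ (P (-b m) → P (-b (m - k))) := by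
    intro k
    induction k with
    | zero => simp
    | succ k ih =>
      intro hk
      obtain ⟨ih₁, ih₂⟩ := ih (by omega)
      have h := key (m - (k + 1)) (by omega)
      rw [show m - (k + 1) + 1 = m - k by omega] at h
      obtain ⟨k1, k2, k3, k4⟩ := h
      exact ⟨fun h => k1.2.2 (k3.2.2 (ih₁ h)), fun h => k2.2.2 (k4.2.2 (ih₂ h))⟩
  refine ⟨(up m le_rfl).1, (up m le_rfl).2, by simpa using (down m le_rfl).1,
    by simpa using (down m le_rfl).2, ?_⟩
  intro ht hb ht' hb' d hd
  obtain ⟨q, hq, hd⟩ := List.mem_flatMap.1 hd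
  obtain ⟨i, hi, hq⟩ := List.mem_flatMap.1 hq
  have hi := List.mem_range.1 hi
  have ht := (up i hi.le).1 ht
  have hb := (up i hi.le).2 hb
  have h := down (m - (i + 1)) (by omega)
  rw [show m - (m - (i + 1)) = i + 1 by omega] at h
  have ht' := h.1 ht'
  have hb' := h.2 hb'
  obtain ⟨k1, k2, k3, k4⟩ := key i hi
  have r1 := k1.1 ht
  have r2 := k2.1 hb
  have r3 := k2.2.1 r1
  have r4 := k1.2.1 r2
  have r5 := k3.1 r4
  have r6 := k4.1 r3
  have r7 := k3.2.2 ht'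
  have r8 := k4.2.2 hb'
  simp only [List.mem_cons, List.not_mem_nil, or_false] at hq hd
  rcases hq with rfl | rfl | rfl | rfl <;> rcases hd with rfl | rfl | rfl <;> assumption

/-- A property that is preserved along the steps of a walk holds on the whole walk. -/
theorem forall_mem_of_isChain {α : Type*} {P : α → Prop} {S : List (α × α)}
    (hS : ∀ p ∈ S, P p.1 → P p.2) {a : α} {w : List α}
    (hw : (a :: w).IsChain fun x y => (x, y) ∈ S) (ha : P a) : ∀ x ∈ a :: w, P x := by
  induction w generalizing a with
  | nil => simpa using ha
  | cons b w ih =>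
    rw [List.isChain_cons_cons] at hw
    intro x hx
    rcases List.mem_cons.1 hx with rfl | hx
    · exact ha
    · exact ih hw.2 (hS _ hw.1 ha) x hx

/-- A closed walk through all entries shows that the steps are connected. -/
theorem stepConnected_of_walk {E : List (ℤ × ℤ × ℤ)} {a : ℤ} {w : List ℤ}
    (ha : a ∈ tripleLabels E) (hw : (a :: w).IsChain fun x y => (x, y) ∈ tripleSteps E)
    (hmem : ∀ d ∈ tripleLabels E, d ∈ a :: w) : StepConnected E :=
  ⟨a, ha, fun _ hP hPa d hd => forall_mem_of_isChain hP hw hPa d (hmem d hd)⟩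

/-- A walk through all entries of the exceptional triples and all entrances of the ladder, where
the ladder may be crossed in a single step, shows that the steps are connected. -/
theorem stepConnected_append_ladder {E : List ((ℤ × ℤ) × (ℤ × ℤ) × (ℤ × ℤ))} {t u b v : ℕ → ℤ}
    {m : ℕ} {t₀ t₁ b₀ b₁ : ℤ × ℤ} (ht₀ : affineEval m t₀ = t 0) (ht₁ : affineEval m t₁ = t m)
    (hb₀ : affineEval m b₀ = b 0) (hb₁ : affineEval m b₁ = b m) {a : ℤ × ℤ} {w : List (ℤ × ℤ)}
    (ha : a ∈ tripleLabels E)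
    (hw : (a :: w).IsChain fun x y =>
      (x, y) ∈ tripleSteps E ++ [(t₀, t₁), (b₀, b₁), (-t₁, -t₀), (-b₁, -b₀)])
    (hmem : ∀ d ∈ tripleLabels E ++ [t₀, b₀, -t₁, -b₁], d ∈ a :: w) :
    StepConnected (E.map (affineTriple m) ++ ladderTriples t u b v m) := by
  refine ⟨affineEval m a, ?_, fun P hP hPa => ?_⟩
  · rw [tripleLabels_append, tripleLabels_map_affineTriple]
    exact List.mem_append_left _ (List.mem_map_of_mem ha)
  · rw [tripleSteps_append, tripleSteps_map_affineTriple] at hP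
    obtain ⟨h1, h2, h3, h4, h5⟩ := ladder_steps fun p hp => hP p (List.mem_append_right _ hp)
    have hwalk : ∀ x ∈ a :: w, P (affineEval m x) := by
      refine forall_mem_of_isChain (P := fun x => P (affineEval m x)) ?_ hw hPa
      intro p hp
      rcases List.mem_append.1 hp with hp | hp
      · exact hP _ (List.mem_append_left _ (List.mem_map_of_mem hp))
      · simp only [List.mem_cons, List.not_mem_nil, or_false] at hp
        rcases hp with rfl | rfl | rfl | rfl <;> simpa only [affineEval_neg, ht₀, ht₁, hb₀, hb₁]
    intro d hd
    rw [tripleLabels_append, tripleLabels_map_affineTriple] at hd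
    rcases List.mem_append.1 hd with hd | hd
    · obtain ⟨x, hx, rfl⟩ := List.mem_map.1 hd
      exact hwalk x (hmem x (List.mem_append_left _ hx))
    · have e1 := hwalk t₀ (hmem _ (List.mem_append_right _ (by simp)))
      have e2 := hwalk b₀ (hmem _ (List.mem_append_right _ (by simp)))
      have e3 := hwalk (-t₁) (hmem _ (List.mem_append_right _ (by simp)))
      have e4 := hwalk (-b₁) (hmem _ (List.mem_append_right _ (by simp)))
      rw [affineEval_neg] at e3 e4
      rw [ht₀] at e1
      rw [hb₀] at e2
      rw [ht₁] at e3
      rw [hb₁] at e4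
      exact h5 e1 e2 e3 e4 d hd

theorem mem_labels_of_exceptional {E : List ((ℤ × ℤ) × (ℤ × ℤ) × (ℤ × ℤ))}
    {M : List (ℤ × ℤ × ℤ)} {m : ℤ} (p : ℤ × ℤ) (hp : p ∈ tripleLabels E) {d : ℤ}
    (h : d = p.1 * m + p.2) : d ∈ tripleLabels (E.map (affineTriple m) ++ M) := by
  rw [tripleLabels_append, tripleLabels_map_affineTriple]
  exact List.mem_append_left _ (List.mem_map.2 ⟨p, hp, h.symm⟩)

theorem mem_labels_of_ladder {L : List (ℤ × ℤ × ℤ)} {t u b v : ℕ → ℤ} {m : ℕ} (i : ℕ)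
    (hi : i < m) {d : ℤ}
    (h : d = t i ∨ d = u i - t i ∨ d = -u i ∨ d = b i ∨ d = t i - u i ∨ d = -v i ∨
      d = u i ∨ d = t (i + 1) - u i ∨ d = -t (i + 1) ∨ d = v i ∨ d = u i - t (i + 1) ∨
      d = -b (i + 1)) : d ∈ tripleLabels (L ++ ladderTriples t u b v m) := by
  rw [tripleLabels_append]
  refine List.mem_append_right _ ?_
  simp only [tripleLabels, ladderTriples, List.mem_flatMap, List.mem_range]
  have mem : ∀ q ∈ [(t i, u i - t i, -u i), (b i, t i - u i, -v i),
      (u i, t (i + 1) - u i, -t (i + 1)), (v i, u i - t (i + 1), -b (i + 1))],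
      d ∈ [q.1, q.2.1, q.2.2] → ∃ q, (∃ i < m, q ∈ [(t i, u i - t i, -u i), (b i, t i - u i, -v i),
      (u i, t (i + 1) - u i, -t (i + 1)), (v i, u i - t (i + 1), -b (i + 1))]) ∧
      d ∈ [q.1, q.2.1, q.2.2] := fun q hq hd => ⟨q, ⟨i, hi, hq⟩, hd⟩
  simp only [List.mem_cons, List.not_mem_nil, or_false, forall_eq_or_imp, forall_eq] at mem
  rcases mem with ⟨m1, m2, m3, m4⟩
  simp only [List.mem_cons, List.not_mem_nil, or_false]
  rcases h with h | h | h | h | h | h | h | h | h | h | h | h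
  · exact m1 (by simp [h])
  · exact m1 (by simp [h])
  · exact m1 (by simp [h])
  · exact m2 (by simp [h])
  · exact m2 (by simp [h])
  · exact m2 (by simp [h])
  · exact m3 (by simp [h])
  · exact m3 (by simp [h])
  · exact m3 (by simp [h])
  · exact m4 (by simp [h])
  · exact m4 (by simp [h])
  · exact m4 (by simp [h])

theorem mem_mainX₁ {s x : ℕ} :
    x ∈ mainX₁ s ↔ x = 1 ∨ x = 6 ∨ ((1 ≤ x ∧ x ≤ 12 * s + 6) ∧
      (x % 6 = 2 ∨ x % 6 = 3 ∨ x % 6 = 5) ∧ x ≠ 6 * s + 2 ∧ x ≠ 12 * s + 5) := by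
  simp [mainX₁]

theorem mem_mainX₂ {s x : ℕ} :
    x ∈ mainX₂ s ↔ (1 ≤ x ∧ x ≤ 12 * s + 6) ∧ ¬ (x = 1 ∨ x = 6 ∨ ((1 ≤ x ∧ x ≤ 12 * s + 6) ∧
      (x % 6 = 2 ∨ x % 6 = 3 ∨ x % 6 = 5) ∧ x ≠ 6 * s + 2 ∧ x ≠ 12 * s + 5)) := by
  rw [mainX₂, Finset.mem_sdiff, mem_mainX₁, Finset.mem_Icc]

theorem mainX₁_subset (s : ℕ) : mainX₁ s ⊆ Finset.Icc 1 (12 * s + 6) := by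
  intro x hx
  rw [mem_mainX₁] at hx
  rw [Finset.mem_Icc]
  omega

theorem card_filter_mod_six (s : ℕ) :
    ((Finset.Icc 1 (12 * s + 6)).filter
      fun i => i % 6 = 2 ∨ i % 6 = 3 ∨ i % 6 = 5).card = 6 * s + 3 := by
  have h : ∀ k : ℕ, ((Finset.range (6 * k)).filter
      fun i => (i + 1) % 6 = 2 ∨ (i + 1) % 6 = 3 ∨ (i + 1) % 6 = 5).card = 3 * k := by
    intro k
    induction k with
    | zero => rfl
    | succ k ih =>
      rw [Finset.card_filter] at ih ⊢
      rw [show 6 * (k + 1) = 6 * k + 1 + 1 + 1 + 1 + 1 + 1 by ring]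
      simp only [Finset.sum_range_succ]
      rw [ih, if_neg (by omega), if_pos (by omega), if_pos (by omega), if_neg (by omega),
        if_pos (by omega), if_neg (by omega)]
      ring
  have h' := h (2 * s + 1)
  rw [Finset.range_eq_Ico] at h'
  rw [show 6 * s + 3 = 3 * (2 * s + 1) by ring, ← h']
  refine (Finset.card_bij (fun i _ => i + 1) ?_ ?_ ?_).symm
  · intro i hi
    simp only [Finset.mem_filter, Finset.mem_Ico, Finset.mem_Icc] at hi ⊢
    omega
  · intro i _ j _ hij
    omega
  · intro i hi
    simp only [Finset.mem_filter, Finset.mem_Icc] at hi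
    refine ⟨i - 1, ?_, by omega⟩
    simp only [Finset.mem_filter, Finset.mem_Ico]
    rw [show i - 1 + 1 = i by omega]
    omega

theorem card_mainX₁ {s : ℕ} (hs : 1 ≤ s) : (mainX₁ s).card = 6 * s + 3 := by
  set F := (Finset.Icc 1 (12 * s + 6)).filter
    fun i => i % 6 = 2 ∨ i % 6 = 3 ∨ i % 6 = 5 with hF
  have h : mainX₁ s = insert 1 (insert 6 ((F.erase (6 * s + 2)).erase (12 * s + 5))) := by
    ext x
    simp only [mem_mainX₁, hF, Finset.mem_insert, Finset.mem_erase, Finset.mem_filter,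
      Finset.mem_Icc]
    tauto
  have hc : F.card = 6 * s + 3 := card_filter_mod_six s
  have h1 : 6 * s + 2 ∈ F := by
    simp only [hF, Finset.mem_filter, Finset.mem_Icc]
    omega
  have h2 : 12 * s + 5 ∈ F.erase (6 * s + 2) := by
    simp only [hF, Finset.mem_erase, Finset.mem_filter, Finset.mem_Icc]
    omega
  rw [h, Finset.card_insert_of_notMem, Finset.card_insert_of_notMem, Finset.card_erase_of_mem h2,
    Finset.card_erase_of_mem h1, hc]
  · omega
  · simp [hF]
  · simp [hF]

theorem card_mainX₂ {s : ℕ} (hs : 1 ≤ s) : (mainX₂ s).card = 6 * s + 3 := by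
  rw [mainX₂, Finset.card_sdiff_of_subset (mainX₁_subset s), card_mainX₁ hs, Nat.card_Icc]
  omega

/-- The exceptional vertices of the current graph for `mainX₁`, with labels affine in `s - 4`. -/
def firstExceptional : List ((ℤ × ℤ) × (ℤ × ℤ) × (ℤ × ℤ)) :=
  [((-12, -27), (0, -14), (12, 41)), ((0, 21), (-6, -35), (6, 14)),
   ((12, 27), (-12, -33), (0, 6)), ((0, 15), (-6, -32), (6, 17)),
   ((6, 23), (0, -3), (-6, -20)), ((6, 38), (0, -21), (-6, -17)),
   ((0, -9), (-6, -23), (6, 32)), ((0, 9), (-6, -29), (6, 20)), ((6, 35), (6, 29), (12, 45)),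
   ((-12, -44), (-12, -50), (0, -15)), ((0, 2), (-12, -41), (12, 39)),
   ((0, 5), (-12, -38), (12, 33)), ((0, 3), (0, -2), (0, -1)), ((12, 51), (12, 50), (0, 8)),
   ((12, 44), (-12, -45), (0, 1)), ((-12, -47), (-12, -51), (0, -11)),
   ((-12, -39), (0, -8), (12, 47)), ((0, 11), (0, -5), (0, -6))]

/-- The current graph for `mainX₁`. -/
def firstTriples (m : ℕ) : List (ℤ × ℤ × ℤ) :=
  firstExceptional.map (affineTriple m) ++
    ladderTriples (fun i => 14 + 6 * i) (fun i => 12 * m + 35 - 6 * i)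
      (fun i => 12 * m + 38 - 6 * i) (fun i => 17 + 6 * i) m

theorem stepConnected_firstTriples (m : ℕ) : StepConnected (firstTriples m) := by
  refine stepConnected_append_ladder (t₀ := (0, 14)) (t₁ := (6, 14)) (b₀ := (12, 38))
    (b₁ := (6, 38)) (by simp [affineEval]) (by simp [affineEval]; ring) (by simp [affineEval])
    (by simp [affineEval]; ring) (a := (-12, -27)) (w :=
  [(0, 14), (6, 14), (0, -21), (6, 17), (0, -15), (12, 44), (12, 45), (-6, -35), (-6, -14),
   (0, -14), (-12, -41), (-12, -39), (0, 8), (-12, -51), (0, 11), (0, 5), (12, 38), (6, 38),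
   (0, 21), (6, 35), (-6, -29), (-6, -20), (-6, -23), (-6, -32), (-6, -17), (-6, -38),
   (-12, -38), (-12, -33), (0, -6), (0, -11), (12, 47), (12, 39), (0, -2), (0, 1), (-12, -44),
   (12, 50), (0, -8), (-12, -47), (12, 51), (-12, -50), (0, 15), (6, 32), (0, 9), (6, 29),
   (-12, -45), (0, -1), (0, -3), (6, 20), (0, -9), (6, 23), (0, 3), (0, 2), (12, 41),
   (12, 27), (12, 33), (0, -5), (0, 6)])
    (by decide +kernel) (by decide +kernel) (by decide +kernel)

theorem dvd_sum_firstTriples (m : ℕ) :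
    ∀ t ∈ firstTriples m, ((24 * (m + 4) + 13 : ℕ) : ℤ) ∣ t.1 + t.2.1 + t.2.2 := by
  intro t ht
  rcases List.mem_append.1 ht with ht | ht
  · obtain ⟨q, hq, rfl⟩ := List.mem_map.1 ht
    have h : ∀ q ∈ firstExceptional, ∃ k ∈ [(0 : ℤ), 1, -1],
        q.1.1 + q.2.1.1 + q.2.2.1 = 24 * k ∧ q.1.2 + q.2.1.2 + q.2.2.2 = 109 * k := by decide
    obtain ⟨k, -, h1, h2⟩ := h q hq
    refine ⟨k, ?_⟩
    simp only [affineTriple, affineEval]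
    push_cast
    linear_combination (m : ℤ) * h1 + h2
  · obtain ⟨i, -, ht⟩ := List.mem_flatMap.1 ht
    simp only [List.mem_cons, List.not_mem_nil, or_false] at ht
    rcases ht with rfl | rfl | rfl | rfl <;> refine ⟨0, ?_⟩ <;> push_cast <;> ring

theorem mem_labels_firstTriples (m x : ℕ) (hx : x ∈ mainX₁ (m + 4)) :
    (x : ℤ) ∈ tripleLabels (firstTriples m) ∧ -(x : ℤ) ∈ tripleLabels (firstTriples m) := by
  rw [mem_mainX₁] at hx
  constructor
  · rcases (by omega : x = 1 ∨ x = 6 ∨ x % 6 = 2 ∨ x % 6 = 3 ∨ x % 6 = 5) with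
      h | h | h | h | h
    · exact mem_labels_of_exceptional (0, 1) (by decide) (by dsimp only; omega)
    · exact mem_labels_of_exceptional (0, 6) (by decide) (by dsimp only; omega)
    · have hb : 2 ≤ x ∧ x ≤ 12 * m + 50 ∧ x ≠ 6 * m + 26 := by omega
      clear hx
      rcases (by omega : x = 2 ∨ 8 ≤ x) with h' | h'
      · exact mem_labels_of_exceptional (0, 2) (by decide) (by dsimp only; omega)
      rcases (by omega : x = 8 ∨ 14 ≤ x) with h' | h'
      · exact mem_labels_of_exceptional (0, 8) (by decide) (by dsimp only; omega)
      rcases (by omega : x ≤ 6 * m + 8 ∨ 6 * m + 14 ≤ x) with h' | h'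
      · exact mem_labels_of_ladder ((x - 14) / 6) (by omega) (by omega)
      rcases (by omega : x = 6 * m + 14 ∨ 6 * m + 20 ≤ x) with h' | h'
      · exact mem_labels_of_exceptional (6, 14) (by decide) (by dsimp only; omega)
      rcases (by omega : x = 6 * m + 20 ∨ 6 * m + 32 ≤ x) with h' | h'
      · exact mem_labels_of_exceptional (6, 20) (by decide) (by dsimp only; omega)
      rcases (by omega : x = 6 * m + 32 ∨ 6 * m + 38 ≤ x) with h' | h'
      · exact mem_labels_of_exceptional (6, 32) (by decide) (by dsimp only; omega)
      rcases (by omega : x = 6 * m + 38 ∨ 6 * m + 44 ≤ x) with h' | h'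
      · exact mem_labels_of_exceptional (6, 38) (by decide) (by dsimp only; omega)
      rcases (by omega : x ≤ 12 * m + 38 ∨ 12 * m + 44 ≤ x) with h' | h'
      · exact mem_labels_of_ladder ((12 * m + 38 - x) / 6) (by omega) (by omega)
      rcases (by omega : x = 12 * m + 44 ∨ 12 * m + 50 ≤ x) with h' | h'
      · exact mem_labels_of_exceptional (12, 44) (by decide) (by dsimp only; omega)
      exact mem_labels_of_exceptional (12, 50) (by decide) (by dsimp only; omega)
    · have hb : 3 ≤ x ∧ x ≤ 12 * m + 51 := by omega
      clear hx
      rcases (by omega : x = 3 ∨ 9 ≤ x) with h' | h'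
      · exact mem_labels_of_exceptional (0, 3) (by decide) (by dsimp only; omega)
      rcases (by omega : x = 9 ∨ 15 ≤ x) with h' | h'
      · exact mem_labels_of_exceptional (0, 9) (by decide) (by dsimp only; omega)
      rcases (by omega : x = 15 ∨ 21 ≤ x) with h' | h'
      · exact mem_labels_of_exceptional (0, 15) (by decide) (by dsimp only; omega)
      rcases (by omega : x = 21 ∨ 27 ≤ x) with h' | h'
      · exact mem_labels_of_exceptional (0, 21) (by decide) (by dsimp only; omega)
      rcases (by omega : x ≤ 12 * m + 21 ∨ 12 * m + 27 ≤ x) with h' | h'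
      · rcases (by omega : x % 12 = 9 ∨ x % 12 = 3) with h'' | h''
        · exact mem_labels_of_ladder ((12 * m + 21 - x) / 12) (by omega) (by omega)
        · exact mem_labels_of_ladder ((12 * m + 15 - x) / 12) (by omega) (by omega)
      rcases (by omega : x = 12 * m + 27 ∨ 12 * m + 33 ≤ x) with h' | h'
      · exact mem_labels_of_exceptional (12, 27) (by decide) (by dsimp only; omega)
      rcases (by omega : x = 12 * m + 33 ∨ 12 * m + 39 ≤ x) with h' | h'
      · exact mem_labels_of_exceptional (12, 33) (by decide) (by dsimp only; omega)
      rcases (by omega : x = 12 * m + 39 ∨ 12 * m + 45 ≤ x) with h' | h'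
      · exact mem_labels_of_exceptional (12, 39) (by decide) (by dsimp only; omega)
      rcases (by omega : x = 12 * m + 45 ∨ 12 * m + 51 ≤ x) with h' | h'
      · exact mem_labels_of_exceptional (12, 45) (by decide) (by dsimp only; omega)
      exact mem_labels_of_exceptional (12, 51) (by decide) (by dsimp only; omega)
    · have hb : 5 ≤ x ∧ x ≤ 12 * m + 47 := by omega
      clear hx
      rcases (by omega : x = 5 ∨ 11 ≤ x) with h' | h'
      · exact mem_labels_of_exceptional (0, 5) (by decide) (by dsimp only; omega)
      rcases (by omega : x = 11 ∨ 17 ≤ x) with h' | h'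
      · exact mem_labels_of_exceptional (0, 11) (by decide) (by dsimp only; omega)
      rcases (by omega : x ≤ 6 * m + 11 ∨ 6 * m + 17 ≤ x) with h' | h'
      · exact mem_labels_of_ladder ((x - 17) / 6) (by omega) (by omega)
      rcases (by omega : x = 6 * m + 17 ∨ 6 * m + 23 ≤ x) with h' | h'
      · exact mem_labels_of_exceptional (6, 17) (by decide) (by dsimp only; omega)
      rcases (by omega : x = 6 * m + 23 ∨ 6 * m + 29 ≤ x) with h' | h'
      · exact mem_labels_of_exceptional (6, 23) (by decide) (by dsimp only; omega)
      rcases (by omega : x = 6 * m + 29 ∨ 6 * m + 35 ≤ x) with h' | h'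
      · exact mem_labels_of_exceptional (6, 29) (by decide) (by dsimp only; omega)
      rcases (by omega : x = 6 * m + 35 ∨ 6 * m + 41 ≤ x) with h' | h'
      · exact mem_labels_of_exceptional (6, 35) (by decide) (by dsimp only; omega)
      rcases (by omega : x ≤ 12 * m + 35 ∨ 12 * m + 41 ≤ x) with h' | h'
      · exact mem_labels_of_ladder ((12 * m + 35 - x) / 6) (by omega) (by omega)
      rcases (by omega : x = 12 * m + 41 ∨ 12 * m + 47 ≤ x) with h' | h'
      · exact mem_labels_of_exceptional (12, 41) (by decide) (by dsimp only; omega)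
      exact mem_labels_of_exceptional (12, 47) (by decide) (by dsimp only; omega)
  · rcases (by omega : x = 1 ∨ x = 6 ∨ x % 6 = 2 ∨ x % 6 = 3 ∨ x % 6 = 5) with
      h | h | h | h | h
    · exact mem_labels_of_exceptional (0, -1) (by decide) (by dsimp only; omega)
    · exact mem_labels_of_exceptional (0, -6) (by decide) (by dsimp only; omega)
    · have hb : 2 ≤ x ∧ x ≤ 12 * m + 50 ∧ x ≠ 6 * m + 26 := by omega
      clear hx
      rcases (by omega : x = 2 ∨ 8 ≤ x) with h' | h'
      · exact mem_labels_of_exceptional (0, -2) (by decide) (by dsimp only; omega)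
      rcases (by omega : x = 8 ∨ 14 ≤ x) with h' | h'
      · exact mem_labels_of_exceptional (0, -8) (by decide) (by dsimp only; omega)
      rcases (by omega : x = 14 ∨ 20 ≤ x) with h' | h'
      · exact mem_labels_of_exceptional (0, -14) (by decide) (by dsimp only; omega)
      rcases (by omega : x ≤ 6 * m + 14 ∨ 6 * m + 20 ≤ x) with h' | h'
      · exact mem_labels_of_ladder ((x - 20) / 6) (by omega) (by omega)
      rcases (by omega : x = 6 * m + 20 ∨ 6 * m + 32 ≤ x) with h' | h'
      · exact mem_labels_of_exceptional (-6, -20) (by decide) (by dsimp only; omega)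
      rcases (by omega : x = 6 * m + 32 ∨ 6 * m + 38 ≤ x) with h' | h'
      · exact mem_labels_of_exceptional (-6, -32) (by decide) (by dsimp only; omega)
      rcases (by omega : x ≤ 12 * m + 32 ∨ 12 * m + 38 ≤ x) with h' | h'
      · exact mem_labels_of_ladder ((12 * m + 32 - x) / 6) (by omega) (by omega)
      rcases (by omega : x = 12 * m + 38 ∨ 12 * m + 44 ≤ x) with h' | h'
      · exact mem_labels_of_exceptional (-12, -38) (by decide) (by dsimp only; omega)
      rcases (by omega : x = 12 * m + 44 ∨ 12 * m + 50 ≤ x) with h' | h'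
      · exact mem_labels_of_exceptional (-12, -44) (by decide) (by dsimp only; omega)
      exact mem_labels_of_exceptional (-12, -50) (by decide) (by dsimp only; omega)
    · have hb : 3 ≤ x ∧ x ≤ 12 * m + 51 := by omega
      clear hx
      rcases (by omega : x = 3 ∨ 9 ≤ x) with h' | h'
      · exact mem_labels_of_exceptional (0, -3) (by decide) (by dsimp only; omega)
      rcases (by omega : x = 9 ∨ 15 ≤ x) with h' | h'
      · exact mem_labels_of_exceptional (0, -9) (by decide) (by dsimp only; omega)
      rcases (by omega : x = 15 ∨ 21 ≤ x) with h' | h'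
      · exact mem_labels_of_exceptional (0, -15) (by decide) (by dsimp only; omega)
      rcases (by omega : x = 21 ∨ 27 ≤ x) with h' | h'
      · exact mem_labels_of_exceptional (0, -21) (by decide) (by dsimp only; omega)
      rcases (by omega : x ≤ 12 * m + 21 ∨ 12 * m + 27 ≤ x) with h' | h'
      · rcases (by omega : x % 12 = 9 ∨ x % 12 = 3) with h'' | h''
        · exact mem_labels_of_ladder ((12 * m + 21 - x) / 12) (by omega) (by omega)
        · exact mem_labels_of_ladder ((12 * m + 15 - x) / 12) (by omega) (by omega)
      rcases (by omega : x = 12 * m + 27 ∨ 12 * m + 33 ≤ x) with h' | h'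
      · exact mem_labels_of_exceptional (-12, -27) (by decide) (by dsimp only; omega)
      rcases (by omega : x = 12 * m + 33 ∨ 12 * m + 39 ≤ x) with h' | h'
      · exact mem_labels_of_exceptional (-12, -33) (by decide) (by dsimp only; omega)
      rcases (by omega : x = 12 * m + 39 ∨ 12 * m + 45 ≤ x) with h' | h'
      · exact mem_labels_of_exceptional (-12, -39) (by decide) (by dsimp only; omega)
      rcases (by omega : x = 12 * m + 45 ∨ 12 * m + 51 ≤ x) with h' | h'
      · exact mem_labels_of_exceptional (-12, -45) (by decide) (by dsimp only; omega)
      exact mem_labels_of_exceptional (-12, -51) (by decide) (by dsimp only; omega)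
    · have hb : 5 ≤ x ∧ x ≤ 12 * m + 47 := by omega
      clear hx
      rcases (by omega : x = 5 ∨ 11 ≤ x) with h' | h'
      · exact mem_labels_of_exceptional (0, -5) (by decide) (by dsimp only; omega)
      rcases (by omega : x = 11 ∨ 17 ≤ x) with h' | h'
      · exact mem_labels_of_exceptional (0, -11) (by decide) (by dsimp only; omega)
      rcases (by omega : x ≤ 6 * m + 11 ∨ 6 * m + 17 ≤ x) with h' | h'
      · exact mem_labels_of_ladder ((x - 17) / 6) (by omega) (by omega)
      rcases (by omega : x = 6 * m + 17 ∨ 6 * m + 23 ≤ x) with h' | h'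
      · exact mem_labels_of_exceptional (-6, -17) (by decide) (by dsimp only; omega)
      rcases (by omega : x = 6 * m + 23 ∨ 6 * m + 29 ≤ x) with h' | h'
      · exact mem_labels_of_exceptional (-6, -23) (by decide) (by dsimp only; omega)
      rcases (by omega : x = 6 * m + 29 ∨ 6 * m + 35 ≤ x) with h' | h'
      · exact mem_labels_of_exceptional (-6, -29) (by decide) (by dsimp only; omega)
      rcases (by omega : x = 6 * m + 35 ∨ 6 * m + 41 ≤ x) with h' | h'
      · exact mem_labels_of_exceptional (-6, -35) (by decide) (by dsimp only; omega)
      rcases (by omega : x ≤ 12 * m + 35 ∨ 12 * m + 41 ≤ x) with h' | h'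
      · exact mem_labels_of_ladder ((12 * m + 35 - x) / 6) (by omega) (by omega)
      rcases (by omega : x = 12 * m + 41 ∨ 12 * m + 47 ≤ x) with h' | h'
      · exact mem_labels_of_exceptional (-12, -41) (by decide) (by dsimp only; omega)
      exact mem_labels_of_exceptional (-12, -47) (by decide) (by dsimp only; omega)

/-- The exceptional vertices of the current graph for `mainX₂`, with labels affine in `s - 1`. -/
def secondExceptional : List ((ℤ × ℤ) × (ℤ × ℤ) × (ℤ × ℤ)) :=
  [((-6, -10), (-6, -8), (12, 18)), ((12, 17), (-6, -4), (-6, -13)),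
   ((0, 4), (-12, -16), (12, 12)), ((0, -7), (-12, -18), (-12, -12)),
   ((12, 16), (6, 8), (6, 13)), ((6, 10), (-12, -17), (6, 7))]

/-- The current graph for `mainX₂`. -/
def secondTriples (m : ℕ) : List (ℤ × ℤ × ℤ) :=
  secondExceptional.map (affineTriple m) ++
    ladderTriples (fun i => 7 + 6 * i) (fun i => 12 * m + 13 - 6 * i)
      (fun i => -4 - 6 * i) (fun i => -12 * m - 10 + 6 * i) m

theorem stepConnected_secondTriples (m : ℕ) : StepConnected (secondTriples m) := by
  refine stepConnected_append_ladder (t₀ := (0, 7)) (t₁ := (6, 7)) (b₀ := (0, -4))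
    (b₁ := (-6, -4)) (by simp [affineEval]) (by simp [affineEval]; ring) (by simp [affineEval])
    (by simp [affineEval]; ring) (a := (-6, -10)) (w :=
  [(6, 8), (-6, -13), (-12, -17), (-6, -7), (0, -7), (12, 18), (6, 10), (12, 17), (6, 4),
   (0, 4), (12, 16), (-6, -8), (-12, -18), (12, 12), (0, -4), (-6, -4), (6, 13), (-12, -16),
   (-12, -12), (0, 7), (6, 7)])
    (by decide +kernel) (by decide +kernel) (by decide +kernel)

theorem dvd_sum_secondTriples (m : ℕ) :
    ∀ t ∈ secondTriples m, ((24 * (m + 1) + 13 : ℕ) : ℤ) ∣ t.1 + t.2.1 + t.2.2 := by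
  intro t ht
  rcases List.mem_append.1 ht with ht | ht
  · obtain ⟨q, hq, rfl⟩ := List.mem_map.1 ht
    have h : ∀ q ∈ secondExceptional, ∃ k ∈ [(0 : ℤ), 1, -1],
        q.1.1 + q.2.1.1 + q.2.2.1 = 24 * k ∧ q.1.2 + q.2.1.2 + q.2.2.2 = 37 * k := by decide
    obtain ⟨k, -, h1, h2⟩ := h q hq
    refine ⟨k, ?_⟩
    simp only [affineTriple, affineEval]
    push_cast
    linear_combination (m : ℤ) * h1 + h2
  · obtain ⟨i, -, ht⟩ := List.mem_flatMap.1 ht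
    simp only [List.mem_cons, List.not_mem_nil, or_false] at ht
    rcases ht with rfl | rfl | rfl | rfl <;> refine ⟨0, ?_⟩ <;> push_cast <;> ring

theorem mem_labels_secondTriples (m x : ℕ) (hx : x ∈ mainX₂ (m + 1)) :
    (x : ℤ) ∈ tripleLabels (secondTriples m) ∧ -(x : ℤ) ∈ tripleLabels (secondTriples m) := by
  rw [mem_mainX₂] at hx
  constructor
  · rcases (by omega : x = 6 * m + 8 ∨ x = 12 * m + 17 ∨ x % 6 = 0 ∨ x % 6 = 1 ∨ x % 6 = 4) with
      h | h | h | h | h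
    · exact mem_labels_of_exceptional (6, 8) (by decide) (by dsimp only; omega)
    · exact mem_labels_of_exceptional (12, 17) (by decide) (by dsimp only; omega)
    · have hb : 12 ≤ x ∧ x ≤ 12 * m + 18 := by omega
      clear hx
      rcases (by omega : x ≤ 12 * m + 6 ∨ 12 * m + 12 ≤ x) with h' | h'
      · rcases (by omega : x % 12 = 6 ∨ x % 12 = 0) with h'' | h''
        · exact mem_labels_of_ladder ((12 * m + 6 - x) / 12) (by omega) (by omega)
        · exact mem_labels_of_ladder ((12 * m + 0 - x) / 12) (by omega) (by omega)
      rcases (by omega : x = 12 * m + 12 ∨ 12 * m + 18 ≤ x) with h' | h'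
      · exact mem_labels_of_exceptional (12, 12) (by decide) (by dsimp only; omega)
      exact mem_labels_of_exceptional (12, 18) (by decide) (by dsimp only; omega)
    · have hb : 7 ≤ x ∧ x ≤ 12 * m + 13 := by omega
      clear hx
      rcases (by omega : x ≤ 6 * m + 1 ∨ 6 * m + 7 ≤ x) with h' | h'
      · exact mem_labels_of_ladder ((x - 7) / 6) (by omega) (by omega)
      rcases (by omega : x = 6 * m + 7 ∨ 6 * m + 13 ≤ x) with h' | h'
      · exact mem_labels_of_exceptional (6, 7) (by decide) (by dsimp only; omega)
      rcases (by omega : x = 6 * m + 13 ∨ 6 * m + 19 ≤ x) with h' | h'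
      · exact mem_labels_of_exceptional (6, 13) (by decide) (by dsimp only; omega)
      exact mem_labels_of_ladder ((12 * m + 13 - x) / 6) (by omega) (by omega)
    · have hb : 4 ≤ x ∧ x ≤ 12 * m + 16 := by omega
      clear hx
      rcases (by omega : x = 4 ∨ 10 ≤ x) with h' | h'
      · exact mem_labels_of_exceptional (0, 4) (by decide) (by dsimp only; omega)
      rcases (by omega : x ≤ 6 * m + 4 ∨ 6 * m + 10 ≤ x) with h' | h'
      · exact mem_labels_of_ladder ((x - 10) / 6) (by omega) (by omega)
      rcases (by omega : x = 6 * m + 10 ∨ 6 * m + 16 ≤ x) with h' | h'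
      · exact mem_labels_of_exceptional (6, 10) (by decide) (by dsimp only; omega)
      rcases (by omega : x ≤ 12 * m + 10 ∨ 12 * m + 16 ≤ x) with h' | h'
      · exact mem_labels_of_ladder ((12 * m + 10 - x) / 6) (by omega) (by omega)
      exact mem_labels_of_exceptional (12, 16) (by decide) (by dsimp only; omega)
  · rcases (by omega : x = 6 * m + 8 ∨ x = 12 * m + 17 ∨ x % 6 = 0 ∨ x % 6 = 1 ∨ x % 6 = 4) with
      h | h | h | h | h
    · exact mem_labels_of_exceptional (-6, -8) (by decide) (by dsimp only; omega)
    · exact mem_labels_of_exceptional (-12, -17) (by decide) (by dsimp only; omega)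
    · have hb : 12 ≤ x ∧ x ≤ 12 * m + 18 := by omega
      clear hx
      rcases (by omega : x ≤ 12 * m + 6 ∨ 12 * m + 12 ≤ x) with h' | h'
      · rcases (by omega : x % 12 = 6 ∨ x % 12 = 0) with h'' | h''
        · exact mem_labels_of_ladder ((12 * m + 6 - x) / 12) (by omega) (by omega)
        · exact mem_labels_of_ladder ((12 * m + 0 - x) / 12) (by omega) (by omega)
      rcases (by omega : x = 12 * m + 12 ∨ 12 * m + 18 ≤ x) with h' | h'
      · exact mem_labels_of_exceptional (-12, -12) (by decide) (by dsimp only; omega)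
      exact mem_labels_of_exceptional (-12, -18) (by decide) (by dsimp only; omega)
    · have hb : 7 ≤ x ∧ x ≤ 12 * m + 13 := by omega
      clear hx
      rcases (by omega : x = 7 ∨ 13 ≤ x) with h' | h'
      · exact mem_labels_of_exceptional (0, -7) (by decide) (by dsimp only; omega)
      rcases (by omega : x ≤ 6 * m + 7 ∨ 6 * m + 13 ≤ x) with h' | h'
      · exact mem_labels_of_ladder ((x - 13) / 6) (by omega) (by omega)
      rcases (by omega : x = 6 * m + 13 ∨ 6 * m + 19 ≤ x) with h' | h'
      · exact mem_labels_of_exceptional (-6, -13) (by decide) (by dsimp only; omega)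
      exact mem_labels_of_ladder ((12 * m + 13 - x) / 6) (by omega) (by omega)
    · have hb : 4 ≤ x ∧ x ≤ 12 * m + 16 := by omega
      clear hx
      rcases (by omega : x + 2 ≤ 6 * m ∨ 6 * m + 4 ≤ x) with h' | h'
      · exact mem_labels_of_ladder ((x - 4) / 6) (by omega) (by omega)
      rcases (by omega : x = 6 * m + 4 ∨ 6 * m + 10 ≤ x) with h' | h'
      · exact mem_labels_of_exceptional (-6, -4) (by decide) (by dsimp only; omega)
      rcases (by omega : x = 6 * m + 10 ∨ 6 * m + 16 ≤ x) with h' | h'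
      · exact mem_labels_of_exceptional (-6, -10) (by decide) (by dsimp only; omega)
      rcases (by omega : x ≤ 12 * m + 10 ∨ 12 * m + 16 ≤ x) with h' | h'
      · exact mem_labels_of_ladder ((12 * m + 10 - x) / 6) (by omega) (by omega)
      exact mem_labels_of_exceptional (-12, -16) (by decide) (by dsimp only; omega)

theorem exists_triangular_mainX₁ {s : ℕ} (hs : 1 ≤ s) :
    ∃ R : RotationSystem (circulant (24 * s + 13) ↑(mainX₁ s)), R.Triangular := by
  have hX : ∀ x ∈ mainX₁ s, 1 ≤ x ∧ x ≤ (24 * s + 13) / 2 := by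
    intro x hx
    have := Finset.mem_Icc.1 (mainX₁_subset s hx)
    omega
  have hodd : Odd (24 * s + 13) := ⟨12 * s + 6, by ring⟩
  have hcard := card_mainX₁ hs
  rcases (by omega : s = 1 ∨ s = 2 ∨ s = 3 ∨ 4 ≤ s) with rfl | rfl | rfl | h
  · refine exists_triangular_of_triples hodd hX
      [(15, -14, -1), (3, -5, 2), (-2, -9, 11), (5, -6, 1), (6, -15, 9), (14, -11, -3)]
      (by rw [hcard]; decide) (by decide +kernel) (by decide)
      (stepConnected_of_walk (a := 15) (w :=
        [14, 11, 2, -3, -14, 1, -5, -2, 9, -6, -1, -15, -9, -11, 3, 5, 6])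
        (by decide +kernel) (by decide +kernel) (by decide +kernel))
  · refine exists_triangular_of_triples hodd hX
      [(27, 8, 26), (1, -21, 20), (-27, -23, -11), (2, -17, 15), (-5, -6, 11), (6, -15, 9),
   (-9, -8, 17), (-1, -2, 3), (21, -26, 5), (-20, -3, 23)]
      (by rw [hcard]; decide) (by decide +kernel) (by decide)
      (stepConnected_of_walk (a := 27) (w :=
        [-8, -17, -15, -9, 8, -26, -5, 6, 15, -2, -3, -23, 11, 5, -21, -20, 3, 1, 21, 26, -27, 23,
   20, -1, 2, 17, 9, -6, -11])
        (by decide +kernel) (by decide +kernel) (by decide +kernel))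
  · refine exists_triangular_of_triples hodd hX
      [(39, 8, 38), (1, -33, 32), (-39, 6, 33), (-35, -29, -21), (-3, -23, 26), (-11, 2, 9),
   (14, 3, -17), (-5, -6, 11), (5, -32, 27), (35, -9, -26), (-27, -2, 29), (17, -38, 21),
   (-1, -14, 15), (23, -15, -8)]
      (by rw [hcard]; decide) (by decide +kernel) (by decide)
      (stepConnected_of_walk (a := 39) (w :=
        [-8, -23, -26, -35, 29, 27, -5, 6, -33, -32, -27, 2, -9, 26, 3, 17, 38, -39, -6, -11, -2,
   -29, 21, -17, -14, -15, 8, -38, -21, 35, 9, 11, 5, 32, -1, 14, -3, 23, 15, 1, 33])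
        (by decide +kernel) (by decide +kernel) (by decide +kernel))
  · obtain ⟨m, rfl⟩ := Nat.exists_eq_add_of_le' h
    refine exists_triangular_of_triples hodd hX (firstTriples m) ?_ (mem_labels_firstTriples m)
      (dvd_sum_firstTriples m) (stepConnected_firstTriples m)
    rw [hcard, firstTriples, List.length_append, List.length_map, length_ladderTriples]
    simp only [firstExceptional, List.length_cons, List.length_nil]
    omega

theorem exists_triangular_mainX₂ {s : ℕ} (hs : 1 ≤ s) :
    ∃ R : RotationSystem (circulant (24 * s + 13) ↑(mainX₂ s)), R.Triangular := by
  have hX : ∀ x ∈ mainX₂ s, 1 ≤ x ∧ x ≤ (24 * s + 13) / 2 := by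
    intro x hx
    have := Finset.mem_Icc.1 (Finset.sdiff_subset hx)
    omega
  have hodd : Odd (24 * s + 13) := ⟨12 * s + 6, by ring⟩
  have hcard := card_mainX₂ hs
  obtain ⟨m, rfl⟩ := Nat.exists_eq_add_of_le' hs
  refine exists_triangular_of_triples hodd hX (secondTriples m) ?_ (mem_labels_secondTriples m)
    (dvd_sum_secondTriples m) (stepConnected_secondTriples m)
  rw [hcard, secondTriples, List.length_append, List.length_map, length_ladderTriples]
  simp only [secondExceptional, List.length_cons, List.length_nil]
  omega

/-- The main construction: for every `s ≥ 1`, with `n = 24s+13`, the sets `X₁` and `X₂` both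
have `6s+3` elements, the circulant graphs `C(n, X₁)` and `C(n, X₂)` partition the edge set of
the complete graph on `ℤ/nℤ`, and each admits a triangular rotation system. -/
theorem main_construction (s : ℕ) (hs : 1 ≤ s) :
    (mainX₁ s).card = 6 * s + 3 ∧ (mainX₂ s).card = 6 * s + 3 ∧
    circulant (24 * s + 13) ↑(mainX₁ s) ⊓ circulant (24 * s + 13) ↑(mainX₂ s) = ⊥ ∧
    circulant (24 * s + 13) ↑(mainX₁ s) ⊔ circulant (24 * s + 13) ↑(mainX₂ s) = ⊤ ∧
    (∃ R₁ : RotationSystem (circulant (24 * s + 13) ↑(mainX₁ s)), R₁.Triangular) ∧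
    (∃ R₂ : RotationSystem (circulant (24 * s + 13) ↑(mainX₂ s)), R₂.Triangular) := by
  have hX₁ : ∀ x ∈ mainX₁ s, 1 ≤ x ∧ x ≤ (24 * s + 13) / 2 := by
    intro x hx
    have := Finset.mem_Icc.1 (mainX₁_subset s hx)
    omega
  have hX₂ : ∀ x ∈ mainX₂ s, 1 ≤ x ∧ x ≤ (24 * s + 13) / 2 := by
    intro x hx
    have := Finset.mem_Icc.1 (Finset.sdiff_subset hx)
    omega
  refine ⟨card_mainX₁ hs, card_mainX₂ hs, ?_, ?_, exists_triangular_mainX₁ hs,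
    exists_triangular_mainX₂ hs⟩
  · ext i j
    rw [SimpleGraph.inf_adj, circulant_adj hX₁, circulant_adj hX₂, SimpleGraph.bot_adj, mainX₂,
      Finset.mem_sdiff]
    tauto
  · ext i j
    rw [SimpleGraph.sup_adj, circulant_adj hX₁, circulant_adj hX₂, SimpleGraph.top_adj]
    constructor
    · rintro h rfl
      rcases h with h | h
      · simpa using hX₁ _ h
      · simpa using hX₂ _ h
    · intro hij
      rw [mainX₂, Finset.mem_sdiff, Finset.mem_Icc]
      have h1 : (j - i).valMinAbs.natAbs ≠ 0 := by
        simpa [sub_eq_zero] using hij.symm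
      have h2 := ZMod.natAbs_valMinAbs_le (j - i)
      have h3 : 1 ≤ (j - i).valMinAbs.natAbs ∧ (j - i).valMinAbs.natAbs ≤ 12 * s + 6 := by
        omega
      tauto
end

section
/- Let G be a finite simple graph on n ≥ 3 vertices whose edge set is partitioned into two spanning subgraphs G₁ and G₂, each equipped with a rotation system all of whose faces have length at least 3, with F₁ (respectively F₂) faces. Let g be an integer such that 2 − n + |E(G_i)| − F_i ≤ 2g for i = 1, 2. Then |E(G)| ≤ 6n − 12 + 12g, and equality holds if and only if both rotation systems are triangular and 2 − n + |E(G_i)| − F_i = 2g for i = 1, 2. -/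
namespace Function

variable {α : Type*} {f : α → α}

theorem ncard_range_iterate {a : α} (ha : 0 < minimalPeriod f a) :
    (Set.range fun k : ℕ => f^[k] a).ncard = minimalPeriod f a := by
  have himage : (Set.range fun k : ℕ => f^[k] a) =
      (fun k : ℕ => f^[k] a) '' Set.Iio (minimalPeriod f a) := by
    refine Set.Subset.antisymm ?_ (Set.image_subset_range _ _)
    rintro _ ⟨k, rfl⟩
    exact ⟨k % minimalPeriod f a, Nat.mod_lt _ ha, iterate_mod_minimalPeriod_eq⟩
  rw [himage, iterate_injOn_Iio_minimalPeriod.ncard_image,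
    ← Finset.coe_Iio, Set.ncard_coe_finset, Nat.card_Iio]

theorem range_iterate_eq_iff_mem {a b : α} (ha : 0 < minimalPeriod f a) :
    (Set.range fun k : ℕ => f^[k] b) = (Set.range fun k : ℕ => f^[k] a) ↔
      b ∈ Set.range fun k : ℕ => f^[k] a := by
  refine ⟨fun h => h ▸ ⟨0, rfl⟩, ?_⟩
  rintro ⟨m, rfl⟩
  refine Set.Subset.antisymm ?_ ?_
  · rintro _ ⟨k, rfl⟩
    exact ⟨k + m, iterate_add_apply f k m a⟩
  · rintro _ ⟨k, rfl⟩
    have hle : m ≤ m * minimalPeriod f a := Nat.le_mul_of_pos_right m ha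
    have hper : f^[m * minimalPeriod f a] a = a :=
      ((isPeriodicPt_minimalPeriod f a).const_mul m).eq
    refine ⟨k + (m * minimalPeriod f a - m), ?_⟩
    dsimp only
    rw [← iterate_add_apply, Nat.add_assoc, Nat.sub_add_cancel hle, iterate_add_apply, hper]

/-- If every point of a finite type has minimal period at least `m`, then `m` times the number
of orbits is at most the number of points, with equality iff all minimal periods are `m`. -/
theorem mul_card_orbits_le_and_eq_iff [Finite α] {m : ℕ} (hm : 0 < m)
    (h : ∀ a, m ≤ minimalPeriod f a) :
    m * Nat.card (Set.range fun a => Set.range fun k : ℕ => f^[k] a) ≤ Nat.card α ∧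
    (m * Nat.card (Set.range fun a => Set.range fun k : ℕ => f^[k] a) = Nat.card α ↔
      ∀ a, minimalPeriod f a = m) := by
  classical
  have := Fintype.ofFinite α
  set orb : α → Set α := fun a => Set.range fun k : ℕ => f^[k] a
  have hpos (a : α) : 0 < minimalPeriod f a := hm.trans_le (h a)
  have hfiber (a : α) :
      (Finset.univ.filter fun b => orb b = orb a).card = minimalPeriod f a := by
    rw [← ncard_range_iterate (hpos a), ← Set.ncard_coe_finset]
    congr 1
    ext b
    simpa using range_iterate_eq_iff_mem (hpos a)
  have hcard : Nat.card (Set.range orb) = (Finset.univ.image orb).card := by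
    rw [Nat.card_coe_set_eq, ← Set.ncard_coe_finset, Finset.coe_image, Finset.coe_univ,
      Set.image_univ]
  have hle : ∀ s ∈ Finset.univ.image orb,
      m ≤ (Finset.univ.filter fun b => orb b = s).card := by
    simp only [Finset.mem_image, Finset.mem_univ, true_and, forall_exists_index,
      forall_apply_eq_imp_iff]
    exact fun a => (h a).trans_eq (hfiber a).symm
  rw [hcard, Nat.card_eq_fintype_card, ← Finset.card_univ,
    Finset.card_eq_sum_card_image orb Finset.univ, mul_comm, ← smul_eq_mul,
    ← Finset.sum_const]
  refine ⟨Finset.sum_le_sum hle, (Finset.sum_eq_sum_iff_of_le hle).trans ?_⟩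
  simp only [Finset.mem_image, Finset.mem_univ, true_and, forall_exists_index,
    forall_apply_eq_imp_iff, hfiber]
  exact forall_congr' fun _ => eq_comm

end Function

theorem SimpleGraph.natCard_dart {V : Type*} [Finite V] (G : SimpleGraph V) :
    Nat.card G.Dart = 2 * Nat.card G.edgeSet := by
  classical
  have := Fintype.ofFinite V
  rw [Nat.card_eq_fintype_card, G.dart_card_eq_twice_card_edges, Nat.card_eq_fintype_card,
    SimpleGraph.edgeFinset_card]

theorem SimpleGraph.natCard_edgeSet_sup {V : Type*} [Finite V] {G H : SimpleGraph V}
    (h : Disjoint G H) :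
    Nat.card (G ⊔ H).edgeSet = Nat.card G.edgeSet + Nat.card H.edgeSet := by
  simp only [Nat.card_coe_set_eq, SimpleGraph.edgeSet_sup]
  exact Set.ncard_union_eq (SimpleGraph.disjoint_edgeSet.mpr h)

theorem RotationSystem.three_mul_numFaces_le_and_eq_iff {V : Type*} [Finite V]
    {G : SimpleGraph V} (R : RotationSystem G)
    (h : ∀ d : G.Dart, 3 ≤ Function.minimalPeriod R.facePerm d) :
    3 * R.numFaces ≤ 2 * Nat.card G.edgeSet ∧
    (3 * R.numFaces = 2 * Nat.card G.edgeSet ↔ R.Triangular) := by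
  have : Finite G.Dart := Finite.of_injective _ SimpleGraph.Dart.toProd_injective
  rw [← G.natCard_dart]
  exact Function.mul_card_orbits_le_and_eq_iff three_pos h

/-- Euler-type edge bound for biembeddings. If the edge set of a graph `G` on `n ≥ 3` vertices
is partitioned into `G₁` and `G₂`, each with a rotation system all of whose faces have length
at least 3 and with `F᎐i` faces, and `g` is an integer with `2 - n + |E(Gᵢ)| - Fᵢ ≤ 2g` for
`i = 1, 2`, then `|E(G)| ≤ 6n - 12 + 12g`, with equality iff both rotation systems are
triangular and both Euler quantities equal `2g`. -/
theorem biembedding_edge_bound (n : ℕ) (hn : 3 ≤ n)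
    (G G₁ G₂ : SimpleGraph (Fin n)) (hsup : G₁ ⊔ G₂ = G) (hinf : G₁ ⊓ G₂ = ⊥)
    (R₁ : RotationSystem G₁) (R₂ : RotationSystem G₂)
    (h₁ : ∀ d : G₁.Dart, 3 ≤ Function.minimalPeriod R₁.facePerm d)
    (h₂ : ∀ d : G₂.Dart, 3 ≤ Function.minimalPeriod R₂.facePerm d)
    (g : ℤ)
    (hg₁ : (2 : ℤ) - n + Nat.card G₁.edgeSet - R₁.numFaces ≤ 2 * g)
    (hg₂ : (2 : ℤ) - n + Nat.card G₂.edgeSet - R₂.numFaces ≤ 2 * g) :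
    (Nat.card G.edgeSet : ℤ) ≤ 6 * n - 12 + 12 * g ∧
    ((Nat.card G.edgeSet : ℤ) = 6 * n - 12 + 12 * g ↔
      R₁.Triangular ∧ R₂.Triangular ∧
      (2 : ℤ) - n + Nat.card G₁.edgeSet - R₁.numFaces = 2 * g ∧
      (2 : ℤ) - n + Nat.card G₂.edgeSet - R₂.numFaces = 2 * g) := by
  obtain ⟨hle₁, heq₁⟩ := R₁.three_mul_numFaces_le_and_eq_iff h₁
  obtain ⟨hle₂, heq₂⟩ := R₂.three_mul_numFaces_le_and_eq_iff h₂
  rw [← heq₁, ← heq₂, ← hsup, SimpleGraph.natCard_edgeSet_sup (disjoint_iff.mpr hinf)]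
  omega
end

section
/- Let g ≥ 1 be an integer and let G be a finite simple graph such that every subgraph H of G with at least 3 vertices satisfies |E(H)| ≤ 6|V(H)| − 12 + 12g. Then the chromatic number of G is at most ⌊(13 + √(73 + 96g))/2⌋. -/
/-- Greedy colouring: if every nonempty set `s` of vertices contains a vertex with fewer than `k`
neighbours in `s`, then the graph is `k`-colourable. -/
theorem SimpleGraph.colorable_of_forall_exists_card_lt {V : Type*} [Fintype V] [DecidableEq V]
    (G : SimpleGraph V) [DecidableRel G.Adj] (k : ℕ)
    (h : ∀ s : Finset V, s.Nonempty → ∃ v ∈ s, (s.filter (G.Adj v)).card < k) :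
    G.Colorable k := by
  have key : ∀ s : Finset V, ∃ c : V → ℕ,
      (∀ u ∈ s, c u < k) ∧ ∀ u ∈ s, ∀ v ∈ s, G.Adj u v → c u ≠ c v := by
    intro s
    induction s using Finset.strongInduction with
    | H s ih =>
      rcases s.eq_empty_or_nonempty with rfl | hs
      · exact ⟨fun _ => 0, by simp, by simp⟩
      obtain ⟨v, hv, hlt⟩ := h s hs
      obtain ⟨c, hck, hc⟩ := ih (s.erase v) (Finset.erase_ssubset hv)
      obtain ⟨a, ha, hna⟩ : ∃ a ∈ Finset.range k, a ∉ (s.filter (G.Adj v)).image c :=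
        Finset.exists_mem_notMem_of_card_lt_card
          (Finset.card_image_le.trans_lt (by simpa using hlt))
      have hav : ∀ w ∈ s, G.Adj v w → c w ≠ a := fun w hw hvw hwa =>
        hna (Finset.mem_image.2 ⟨w, Finset.mem_filter.2 ⟨hw, hvw⟩, hwa⟩)
      refine ⟨Function.update c v a, fun u hu => ?_, fun u hu w hw huw => ?_⟩
      · by_cases huv : u = v
        · simpa [huv] using ha
        · simpa [huv] using hck u (by simp [huv, hu])
      · by_cases huv : u = v
        · subst huv
          simpa [huw.ne'] using (hav w hw huw).symm
        · by_cases hwv : w = v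
          · subst hwv
            simpa [huv] using hav u hu huw.symm
          · simpa [huv, hwv] using hc u (by simp [huv, hu]) w (by simp [hwv, hw]) huw
  obtain ⟨c, hck, hc⟩ := key Finset.univ
  exact ⟨SimpleGraph.Coloring.mk (fun v => (⟨c v, hck v (Finset.mem_univ v)⟩ : Fin k))
    fun {u v} huv he => hc u (Finset.mem_univ u) v (Finset.mem_univ v) huv (congrArg Fin.val he)⟩

/-- The handshaking lemma for an induced subgraph, stated with a lower bound on the degrees. -/
theorem SimpleGraph.card_mul_le_two_mul_ncard_edgeSet_induce {V : Type*} [Fintype V]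
    [DecidableEq V] (G : SimpleGraph V) [DecidableRel G.Adj] (k : ℕ) (s : Finset V)
    (hs : ∀ v ∈ s, k ≤ (s.filter (G.Adj v)).card) :
    s.card * k ≤ 2 * ((⊤ : G.Subgraph).induce (s : Set V)).edgeSet.ncard := by
  classical
  set H := (⊤ : G.Subgraph).induce (s : Set V)
  rw [← SimpleGraph.Subgraph.edgeSet_spanningCoe, ← SimpleGraph.coe_edgeFinset,
    Set.ncard_coe_finset, ← SimpleGraph.sum_degrees_eq_twice_card_edges]
  calc s.card * k ≤ ∑ v ∈ s, H.spanningCoe.degree v := by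
        rw [← smul_eq_mul]
        refine Finset.card_nsmul_le_sum _ _ _ fun v hv => (hs v hv).trans ?_
        rw [← SimpleGraph.card_neighborFinset_eq_degree]
        refine Finset.card_le_card fun w hw => ?_
        simpa [H, hv] using hw
    _ ≤ ∑ v, H.spanningCoe.degree v :=
        Finset.sum_le_sum_of_subset (Finset.subset_univ s)

/-- `y = (13 + √(73 + 96g))/2` is the positive root of `y (y - 13) = 24g - 24`; here `k = ⌊y⌋`. -/
theorem exists_floor_eq_natCast_and_lt_mul (g : ℤ) (hg : 1 ≤ g) :
    ∃ k : ℕ, ⌊(13 + Real.sqrt (73 + 96 * (g : ℝ))) / 2⌋.toNat = k ∧ 13 ≤ k ∧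
      24 * g - 24 < ((k : ℤ) + 1) * (k - 12) := by
  set r := Real.sqrt (73 + 96 * (g : ℝ))
  have hg' : (1 : ℝ) ≤ g := by exact_mod_cast hg
  have hsq : r ^ 2 = 73 + 96 * g := Real.sq_sqrt (by linarith)
  have hr13 : 13 ≤ r := Real.le_sqrt_of_sq_le (by linarith)
  have h13 : 13 ≤ ⌊(13 + r) / 2⌋ := Int.le_floor.2 (by push_cast; linarith)
  have hlt : (13 + r) / 2 < ⌊(13 + r) / 2⌋ + 1 := Int.lt_floor_add_one _
  refine ⟨_, rfl, by omega, ?_⟩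
  rw [Int.toNat_of_nonneg (by omega)]
  generalize ⌊(13 + r) / 2⌋ = m at *
  have : (24 * g - 24 : ℝ) < ((m : ℝ) + 1) * (m - 12) := by nlinarith
  exact_mod_cast this

/-- Jackson–Ringel chromatic bound: if every subgraph `H` of a finite simple graph `G` with at
least 3 vertices satisfies `|E(H)| ≤ 6|V(H)| - 12 + 12g` (for a fixed integer `g ≥ 1`), then
`χ(G) ≤ ⌊(13 + √(73 + 96g))/2⌋`. -/
theorem chromatic_bound {V : Type*} [Fintype V] (g : ℤ) (hg : 1 ≤ g)
    (G : SimpleGraph V)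
    (h : ∀ H : G.Subgraph, 3 ≤ H.verts.ncard →
      (H.edgeSet.ncard : ℤ) ≤ 6 * H.verts.ncard - 12 + 12 * g) :
    G.chromaticNumber ≤
      ((⌊(13 + Real.sqrt (73 + 96 * (g : ℝ))) / 2⌋.toNat : ℕ) : ℕ∞) := by
  classical
  obtain ⟨k, hk, hk13, hgk⟩ := exists_floor_eq_natCast_and_lt_mul g hg
  rw [hk]
  refine (G.colorable_of_forall_exists_card_lt k fun s hs => ?_).chromaticNumber_le
  by_contra! hdeg
  obtain ⟨v, hv⟩ := hs
  have hcard : k + 1 ≤ s.card :=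
    (hdeg v hv).trans_lt (Finset.card_lt_card
      (Finset.filter_ssubset.2 ⟨v, hv, G.loopless.irrefl v⟩))
  have hE := h ((⊤ : G.Subgraph).induce (s : Set V)) (by simp; omega)
  have hdeg_sum := G.card_mul_le_two_mul_ncard_edgeSet_induce k s hdeg
  rw [SimpleGraph.Subgraph.induce_verts, Set.ncard_coe_finset] at hE
  zify at hcard hdeg_sum hk13
  nlinarith
end

section
/- Let g ≥ 1 be an integer and let G be a finite simple graph with at least one vertex such that every subgraph H of G with at least 3 vertices satisfies |E(H)| ≤ 6|V(H)| − 12 + 12g. Then G has a vertex of degree at most ⌊(13 + √(73 + 96g))/2⌋ − 1. -/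
/-- If every subgraph `H` of a finite simple graph `G` with at least 3 vertices satisfies
`|E(H)| ≤ 6|V(H)| - 12 + 12g` (for a fixed integer `g ≥ 1`), then `G` has a vertex of degree
at most `⌊(13 + √(73 + 96g))/2⌋ - 1`. -/
theorem min_degree_bound {V : Type*} [Fintype V] [Nonempty V] (g : ℤ) (hg : 1 ≤ g)
    (G : SimpleGraph V)
    (h : ∀ H : G.Subgraph, 3 ≤ H.verts.ncard →
      (H.edgeSet.ncard : ℤ) ≤ 6 * H.verts.ncard - 12 + 12 * g) :
    ∃ v : V, (Nat.card (G.neighborSet v) : ℤ) ≤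
      ⌊(13 + Real.sqrt (73 + 96 * (g : ℝ))) / 2⌋ - 1 := by
  classical
  set s := Real.sqrt (73 + 96 * (g : ℝ)) with hs
  set K : ℤ := ⌊(13 + s) / 2⌋ with hK
  by_contra! hlarge
  have hgR : (1 : ℝ) ≤ g := by exact_mod_cast hg
  have hs13 : 13 ≤ s := Real.le_sqrt_of_sq_le (by linarith)
  have hK13 : 13 ≤ K := Int.le_floor.mpr (by push_cast; linarith)
  have hKquad : 73 + 96 * g < (2 * K - 11) ^ 2 := by
    have hfloor := Int.lt_floor_add_one ((13 + s) / 2)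
    rw [← hK] at hfloor
    have hsq : s ^ 2 = 73 + 96 * (g : ℝ) := Real.sq_sqrt (by linarith)
    have hreal : 73 + 96 * (g : ℝ) < (2 * (K : ℝ) - 11) ^ 2 := by nlinarith
    exact_mod_cast hreal
  have hdeg (v : V) : K ≤ G.degree v := by
    have := hlarge v
    rw [Nat.card_eq_fintype_card, G.card_neighborSet_eq_degree] at this
    omega
  have hcard : K + 1 ≤ Fintype.card V := by
    obtain ⟨v⟩ := ‹Nonempty V›
    have := G.degree_lt_card_verts v
    have := hdeg v
    omega
  have hedge := h ⊤ (by
    simp only [SimpleGraph.Subgraph.verts_top, Set.ncard_univ, Nat.card_eq_fintype_card]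
    omega)
  simp only [SimpleGraph.Subgraph.verts_top, Set.ncard_univ, Nat.card_eq_fintype_card,
    SimpleGraph.Subgraph.edgeSet_top, ← G.coe_edgeFinset, Set.ncard_coe_finset] at hedge
  have hsum : (Fintype.card V : ℤ) * K ≤ 2 * G.edgeFinset.card := by
    have := G.sum_degrees_eq_twice_card_edges
    calc (Fintype.card V : ℤ) * K = ∑ _v : V, K := by simp
      _ ≤ ∑ v : V, (G.degree v : ℤ) := Finset.sum_le_sum fun v _ => hdeg v
      _ = 2 * G.edgeFinset.card := by exact_mod_cast this
  have hmul := mul_le_mul_of_nonneg_right hcard (by omega : 0 ≤ K - 12)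
  nlinarith
end

section
/- There exists a self-complementary finite simple graph on 16 vertices that admits a triangular rotation system. -/
/-- The cyclically ordered neighborhoods of a triangulated self-complementary graph on 16
vertices; `i ↦ i + 1` is an isomorphism onto its complement. -/
def cyclicNeighbors : Fin 16 → List (Fin 16) :=
  ![[1, 10, 8, 2, 5, 4, 7, 6, 14, 3, 12],
    [0, 12, 14, 10],
    [0, 8, 9, 6, 7, 4, 10, 12, 3, 14, 5],
    [0, 14, 2, 12],
    [0, 5, 14, 12, 6, 9, 8, 11, 10, 2, 7],
    [0, 2, 14, 4],
    [0, 7, 2, 9, 4, 12, 13, 10, 11, 8, 14],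
    [0, 4, 2, 6],
    [0, 10, 13, 12, 15, 14, 6, 11, 4, 9, 2],
    [2, 8, 4, 6],
    [0, 1, 14, 15, 12, 2, 4, 11, 6, 13, 8],
    [4, 8, 6, 10],
    [0, 3, 2, 10, 15, 8, 13, 6, 4, 14, 1],
    [6, 12, 8, 10],
    [0, 6, 8, 15, 10, 1, 12, 4, 5, 2, 3],
    [8, 12, 10, 14]]

theorem nodup_cyclicNeighbors (v : Fin 16) : (cyclicNeighbors v).Nodup := by
  revert v; decide

/-- The graph in which the neighbors of `v` are the entries of `cyclicNeighbors v`. -/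
def cyclicNeighborsGraph : SimpleGraph (Fin 16) where
  Adj v u := u ∈ cyclicNeighbors v
  symm := ⟨by decide⟩
  loopless := ⟨by decide⟩

/-- Adding one is an isomorphism from `cyclicNeighborsGraph` to its complement. -/
def cyclicNeighborsGraphIsoCompl : cyclicNeighborsGraph ≃g cyclicNeighborsGraphᶜ where
  toEquiv := Equiv.addRight 1
  map_rel_iff' := by
    have h : ∀ a b : Fin 16, (a + 1 ≠ b + 1 ∧ b + 1 ∉ cyclicNeighbors (a + 1)) ↔
        b ∈ cyclicNeighbors a := by decide
    exact fun {a b} => h a b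

theorem List.exists_formPerm_pow_apply_eq {α : Type*} [DecidableEq α] {l : List α}
    (hl : l.Nodup) {u w : α} (hu : u ∈ l) (hw : w ∈ l) :
    ∃ k : ℕ, (l.formPerm ^ k) u = w := by
  obtain ⟨i, hi, rfl⟩ := List.getElem_of_mem hu
  obtain ⟨j, hj, rfl⟩ := List.getElem_of_mem hw
  refine ⟨l.length - i + j, ?_⟩
  rw [List.formPerm_pow_apply_getElem l hl]
  have h : i + (l.length - i + j) = j + l.length := by omega
  simp only [h, Nat.add_mod_right, Nat.mod_eq_of_lt hj]

/-- The rotation system whose rotation at `v` is the cycle `cyclicNeighbors v`. -/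
def cyclicNeighborsRotation : RotationSystem cyclicNeighborsGraph where
  ρ v := (cyclicNeighbors v).formPerm
  mem_neighbor _ _ h := List.formPerm_apply_mem_of_mem h
  fixes _ _ h := List.formPerm_apply_of_notMem h
  single_cycle v _ _ hu hw := List.exists_formPerm_pow_apply_eq (nodup_cyclicNeighbors v) hu hw

namespace RotationSystem

theorem triangular_of_rotation_eq {V : Type*} {G : SimpleGraph V} (R : RotationSystem G)
    (h : ∀ u v, G.Adj v u → R.ρ (R.ρ v u) v = u) : R.Triangular := by
  intro d
  refine Function.minimalPeriod_eq_prime (p := 3) ?_ ?_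
  · obtain ⟨⟨u, v⟩, hd⟩ := d
    have h₁ := h u v hd.symm
    have h₂ := h v (R.ρ v u) (R.mem_neighbor v u hd.symm).symm
    rw [h₁] at h₂
    apply SimpleGraph.Dart.ext
    simp [facePerm, h₁, h₂]
  · intro hd
    exact d.adj.ne (congrArg (fun e : G.Dart => e.fst) hd).symm

end RotationSystem

theorem cyclicNeighborsRotation_triangular : cyclicNeighborsRotation.Triangular := by
  apply RotationSystem.triangular_of_rotation_eq
  have h : ∀ u v : Fin 16, u ∈ cyclicNeighbors v →
      (cyclicNeighbors ((cyclicNeighbors v).formPerm u)).formPerm v = u := by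
    decide +kernel
  exact h

/-- There exists a self-complementary simple graph on 16 vertices admitting a triangular
rotation system. -/
theorem selfComplementary_triangular_16 :
    ∃ G : SimpleGraph (Fin 16),
      Nonempty (G ≃g Gᶜ) ∧ ∃ R : RotationSystem G, R.Triangular :=
  ⟨cyclicNeighborsGraph, ⟨cyclicNeighborsGraphIsoCompl⟩, cyclicNeighborsRotation,
    cyclicNeighborsRotation_triangular⟩
end

section
/- There exists a self-complementary finite simple graph on 21 vertices that admits a triangular rotation system. -/
/-- The rotation table of a triangular embedding of a self-complementary graph on 21 vertices:
row `v` lists the images of `0, …, 20` under the rotation at `v`, which fixes exactly the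
non-neighbors of `v`. -/
def rotationTable : Fin 21 → Fin 21 → Fin 21 :=
  ![![0, 8, 16, 3, 10, 5, 20, 7, 14, 9, 1, 11, 12, 13, 6, 15, 4, 18, 2, 19, 17],
    ![10, 1, 2, 3, 8, 5, 16, 7, 0, 9, 6, 11, 14, 12, 4, 15, 13, 17, 18, 19, 20],
    ![18, 1, 2, 10, 20, 5, 8, 7, 3, 9, 12, 11, 4, 13, 14, 15, 0, 17, 6, 16, 19],
    ![0, 1, 8, 3, 18, 5, 10, 7, 4, 9, 2, 11, 6, 13, 12, 14, 16, 17, 15, 19, 20],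
    ![16, 14, 12, 8, 4, 10, 18, 7, 1, 9, 0, 11, 5, 13, 20, 15, 6, 17, 3, 19, 2],
    ![0, 1, 2, 3, 12, 5, 6, 7, 16, 9, 4, 11, 8, 13, 18, 15, 14, 17, 10, 19, 20],
    ![14, 10, 18, 12, 16, 5, 6, 8, 2, 9, 3, 11, 20, 13, 7, 15, 1, 17, 4, 19, 0],
    ![0, 1, 2, 3, 4, 5, 14, 7, 6, 9, 18, 11, 16, 13, 10, 15, 8, 17, 12, 19, 20],
    ![1, 4, 6, 2, 3, 12, 7, 16, 8, 14, 10, 11, 17, 13, 0, 15, 5, 19, 18, 9, 20],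
    ![0, 1, 2, 3, 4, 5, 6, 7, 19, 9, 10, 14, 11, 13, 8, 15, 16, 17, 18, 20, 12],
    ![4, 0, 3, 6, 5, 18, 1, 14, 8, 9, 10, 12, 2, 13, 19, 15, 16, 11, 7, 17, 20],
    ![0, 1, 2, 3, 4, 5, 6, 7, 8, 12, 17, 11, 10, 13, 9, 15, 16, 20, 18, 19, 14],
    ![0, 13, 10, 14, 2, 4, 3, 18, 5, 20, 11, 9, 12, 16, 1, 15, 7, 8, 17, 19, 6],
    ![0, 16, 2, 3, 4, 5, 6, 7, 8, 9, 10, 11, 1, 13, 14, 15, 12, 17, 18, 19, 20],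
    ![8, 12, 2, 15, 1, 16, 0, 6, 9, 11, 7, 20, 3, 13, 14, 18, 19, 17, 5, 10, 4],
    ![0, 1, 2, 18, 4, 5, 6, 7, 8, 9, 10, 11, 12, 13, 3, 15, 16, 17, 14, 19, 20],
    ![2, 6, 19, 3, 0, 8, 4, 12, 7, 9, 10, 11, 13, 1, 5, 15, 16, 17, 18, 14, 20],
    ![20, 1, 2, 3, 4, 5, 6, 7, 12, 9, 19, 10, 18, 13, 14, 15, 16, 17, 0, 8, 11],
    ![17, 1, 0, 4, 6, 14, 2, 10, 8, 9, 5, 11, 7, 13, 15, 3, 16, 12, 18, 19, 20],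
    ![0, 1, 20, 3, 4, 5, 6, 7, 17, 8, 14, 11, 12, 13, 16, 15, 2, 10, 18, 19, 9],
    ![6, 1, 4, 3, 14, 5, 12, 7, 8, 19, 10, 17, 9, 13, 11, 15, 16, 0, 18, 2, 20]]

/-- The graph underlying `rotationTable`. -/
def rotationTableGraph : SimpleGraph (Fin 21) where
  Adj v u := rotationTable v u ≠ u
  symm := ⟨by decide +kernel⟩
  loopless := ⟨by decide +kernel⟩

instance : DecidableRel rotationTableGraph.Adj :=
  fun v u => inferInstanceAs (Decidable (rotationTable v u ≠ u))

/-- A permutation of the vertices that exchanges edges and non-edges of `rotationTableGraph`. -/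
def antimorphism : Equiv.Perm (Fin 21) where
  toFun := ![1, 2, 3, 0, 5, 6, 7, 4, 9, 10, 11, 8, 13, 14, 15, 12, 17, 18, 19, 16, 20]
  invFun := ![3, 0, 1, 2, 7, 4, 5, 6, 11, 8, 9, 10, 15, 12, 13, 14, 19, 16, 17, 18, 20]
  left_inv := by decide +kernel
  right_inv := by decide +kernel

/-- `antimorphism` as an isomorphism from `rotationTableGraph` to its complement. -/
def rotationTableGraphIsoCompl : rotationTableGraph ≃g rotationTableGraphᶜ where
  toEquiv := antimorphism
  map_rel_iff' := by
    intro a b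
    rw [SimpleGraph.compl_adj]
    revert a b
    decide +kernel

theorem rotationTable_bijective (v : Fin 21) : Function.Bijective (rotationTable v) := by
  rw [← Finite.injective_iff_bijective]
  revert v
  unfold Function.Injective
  decide +kernel

theorem rotationTable_iterate_eq (v u w : Fin 21) (hu : rotationTable v u ≠ u)
    (hw : rotationTable v w ≠ w) : ∃ k : Fin 21, (rotationTable v)^[k] u = w := by
  revert v u w
  decide +kernel

/-- The rotation system given by `rotationTable`. -/
noncomputable def tableRotationSystem : RotationSystem rotationTableGraph where
  ρ v := Equiv.ofBijective (rotationTable v) (rotationTable_bijective v)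
  mem_neighbor v _ h := fun h' => h ((rotationTable_bijective v).injective h')
  fixes _ _ h := not_not.mp h
  single_cycle v u w hu hw := by
    obtain ⟨k, hk⟩ := rotationTable_iterate_eq v u w hu hw
    refine ⟨k, ?_⟩
    rw [Equiv.Perm.coe_pow]
    exact hk

theorem rotationTable_face (u v : Fin 21) (h : rotationTable u v ≠ v) :
    rotationTable (rotationTable v u) v = u ∧ rotationTable u (rotationTable v u) = v := by
  revert u v
  decide +kernel

theorem tableRotationSystem_triangular : tableRotationSystem.Triangular := by
  intro d
  have : Fact (Nat.Prime 3) := ⟨Nat.prime_three⟩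
  obtain ⟨h₁, h₂⟩ := rotationTable_face d.fst d.snd d.adj
  refine Function.minimalPeriod_eq_prime ?_ ?_
  · refine SimpleGraph.Dart.ext _ _ (Prod.ext h₁ ?_)
    change rotationTable (rotationTable (rotationTable d.snd d.fst) d.snd)
      (rotationTable d.snd d.fst) = d.snd
    rw [h₁, h₂]
  · intro h
    exact d.adj.ne (congrArg (fun e : rotationTableGraph.Dart => e.fst) h).symm

/-- There exists a self-complementary simple graph on 21 vertices admitting a triangular
rotation system. -/
theorem selfComplementary_triangular_21 :
    ∃ G : SimpleGraph (Fin 21),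
      Nonempty (G ≃g Gᶜ) ∧ ∃ R : RotationSystem G, R.Triangular := by
  exact ⟨rotationTableGraph, ⟨rotationTableGraphIsoCompl⟩, tableRotationSystem,
    tableRotationSystem_triangular⟩
end

section
/- There exists a self-complementary finite simple graph on 24 vertices that admits a triangular rotation system. -/
/-- The cyclic order of the neighbors of each vertex in a triangular embedding of a
self-complementary graph on 24 vertices. -/
def neighborCycle : Fin 24 → List (Fin 24) :=
  ![[4, 18, 14, 5, 6, 17, 15, 10, 21, 23, 12, 11, 20, 16, 8],
    [2, 23, 8, 14, 10, 3, 4, 20],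
    [1, 20, 13, 16, 7, 14, 19, 17, 6, 10, 18, 22, 8, 12, 23],
    [1, 10, 22, 6, 5, 12, 16, 4],
    [0, 8, 19, 21, 10, 9, 12, 22, 14, 20, 1, 3, 16, 15, 18],
    [0, 14, 7, 8, 18, 12, 3, 6],
    [0, 5, 3, 22, 12, 20, 14, 11, 18, 23, 21, 16, 10, 2, 17],
    [2, 16, 9, 10, 20, 8, 5, 14],
    [0, 16, 12, 2, 22, 13, 14, 1, 23, 18, 5, 7, 20, 19, 4],
    [4, 10, 7, 16, 22, 18, 11, 12],
    [0, 15, 22, 3, 1, 14, 18, 2, 6, 16, 20, 7, 9, 4, 21],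
    [0, 12, 9, 18, 6, 14, 13, 20],
    [0, 23, 2, 8, 16, 3, 5, 18, 17, 20, 6, 22, 4, 9, 11],
    [2, 20, 11, 14, 8, 22, 15, 16],
    [0, 18, 10, 1, 8, 13, 11, 6, 20, 4, 22, 19, 2, 7, 5],
    [0, 17, 18, 4, 16, 13, 22, 10],
    [0, 20, 10, 6, 21, 22, 9, 7, 2, 13, 15, 4, 3, 12, 8],
    [0, 6, 2, 19, 20, 12, 18, 15],
    [0, 4, 15, 17, 12, 5, 8, 23, 6, 11, 9, 22, 2, 10, 14],
    [2, 14, 22, 21, 4, 8, 20, 17],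
    [0, 11, 13, 2, 1, 4, 14, 6, 12, 17, 19, 8, 7, 10, 16],
    [0, 10, 4, 19, 22, 16, 6, 23],
    [2, 18, 9, 16, 21, 19, 14, 4, 12, 6, 3, 10, 15, 13, 8],
    [0, 21, 6, 18, 8, 1, 2, 12]]

theorem nodup_neighborCycle (v : Fin 24) : (neighborCycle v).Nodup := by
  revert v
  decide +kernel

theorem nontrivial_neighborCycle (v : Fin 24) : 2 ≤ (neighborCycle v).length := by
  revert v
  decide +kernel

/-- The graph on 24 vertices whose neighborhoods are given by `neighborCycle`. -/
def cycleGraph24 : SimpleGraph (Fin 24) where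
  Adj u v := v ∈ neighborCycle u
  symm := ⟨by decide +kernel⟩
  loopless := ⟨by decide +kernel⟩

theorem cycleGraph24_adj {u v : Fin 24} : cycleGraph24.Adj u v ↔ v ∈ neighborCycle u :=
  Iff.rfl

/-- The shift `v ↦ v + 1` maps `cycleGraph24` onto its complement. -/
def cycleGraph24IsoCompl : cycleGraph24 ≃g cycleGraph24ᶜ where
  toEquiv := Equiv.addRight 1
  map_rel_iff' := by
    have h : ∀ u v : Fin 24, (u + 1 ≠ v + 1 ∧ v + 1 ∉ neighborCycle (u + 1)) ↔
        v ∈ neighborCycle u := by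
      decide +kernel
    intro u v
    exact h u v

/-- The rotation system on `cycleGraph24` given by `neighborCycle`. -/
def cycleGraph24Rotation : RotationSystem cycleGraph24 where
  ρ v := (neighborCycle v).formPerm
  mem_neighbor _ _ h := List.formPerm_apply_mem_of_mem h
  fixes _ _ h := List.formPerm_apply_of_notMem h
  single_cycle v u w hu hw := by
    have hmem {x : Fin 24} (hx : x ∈ neighborCycle v) : (neighborCycle v).formPerm x ≠ x :=
      (List.formPerm_apply_mem_ne_self_iff _ (nodup_neighborCycle v) x hx).2
        (nontrivial_neighborCycle v)
    obtain ⟨k, -, hk⟩ := ((List.isCycle_formPerm (nodup_neighborCycle v)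
      (nontrivial_neighborCycle v)).sameCycle (hmem hu) (hmem hw)).exists_pow_eq'
    exact ⟨k, hk⟩

theorem formPerm_neighborCycle_triangle :
    ∀ u, ∀ v ∈ neighborCycle u,
      (neighborCycle ((neighborCycle v).formPerm u)).formPerm v = u ∧
        (neighborCycle u).formPerm ((neighborCycle v).formPerm u) = v := by
  decide +kernel

theorem cycleGraph24Rotation_triangular : cycleGraph24Rotation.Triangular := by
  intro d
  have : Fact (Nat.Prime 3) := ⟨Nat.prime_three⟩
  obtain ⟨h₁, h₂⟩ := formPerm_neighborCycle_triangle d.fst d.snd d.adj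
  refine Function.minimalPeriod_eq_prime (p := 3) ?_ ?_
  · refine SimpleGraph.Dart.ext _ _ (Prod.ext h₁ ?_)
    change (neighborCycle ((neighborCycle ((neighborCycle d.snd).formPerm d.fst)).formPerm
      d.snd)).formPerm ((neighborCycle d.snd).formPerm d.fst) = d.snd
    rw [h₁, h₂]
  · intro h
    exact d.fst_ne_snd (congrArg (fun e : cycleGraph24.Dart => e.fst) h).symm

/-- There exists a self-complementary simple graph on 24 vertices admitting a triangular
rotation system. -/
theorem selfComplementary_triangular_24 :
    ∃ G : SimpleGraph (Fin 24),
      Nonempty (G ≃g Gᶜ) ∧ ∃ R : RotationSystem G, R.Triangular := by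
  exact ⟨cycleGraph24, ⟨cycleGraph24IsoCompl⟩, cycleGraph24Rotation,
    cycleGraph24Rotation_triangular⟩
end

section
/- The complete graph K_16 admits a triangular biembedding: there exist two spanning subgraphs G₁ and G₂ of the complete graph on 16 vertices whose edge sets partition the edge set of K_16, each admitting a triangular rotation system. -/
/-- A function `r` with `r v u ≠ u` exactly when `v` and `u` are adjacent, sending `(v, u)` to the
third vertex `w` of the oriented triangle `(u, v, w)`, gives a rotation system that is triangular
as soon as the links of all vertices are connected. -/
theorem exists_triangular_of_third_vertex {V : Type*} [Finite V] (G : SimpleGraph V)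
    (r : V → V → V) (adj : ∀ v u, G.Adj v u ↔ r v u ≠ u)
    (mem : ∀ v u, G.Adj v u → G.Adj v (r v u))
    (rotate : ∀ v u, G.Adj v u → r (r v u) v = u)
    (cycle : ∀ v u w, G.Adj v u → G.Adj v w → ∃ k : ℕ, (r v)^[k] u = w) :
    ∃ R : RotationSystem G, R.Triangular := by
  have inj : ∀ v, Function.Injective (r v) := by
    intro v a b hab
    by_cases ha : G.Adj v a
    · by_cases hb : G.Adj v b
      · rw [← rotate v a ha, hab, rotate v b hb]
      · have hb' : r v b = b := by simpa [adj] using hb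
        exact absurd (hb' ▸ hab ▸ mem v a ha) hb
    · have ha' : r v a = a := by simpa [adj] using ha
      by_cases hb : G.Adj v b
      · exact absurd (ha' ▸ hab.symm ▸ mem v b hb) ha
      · have hb' : r v b = b := by simpa [adj] using hb
        rw [← ha', hab, hb']
  let R : RotationSystem G :=
    { ρ := fun v => Equiv.ofBijective (r v) (Finite.injective_iff_bijective.mp (inj v))
      mem_neighbor := mem
      fixes := fun v u h => by simpa [adj] using h
      single_cycle := fun v u w hu hw => by
        obtain ⟨k, hk⟩ := cycle v u w hu hw
        refine ⟨k, ?_⟩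
        rw [Equiv.Perm.coe_pow]
        exact hk }
  refine ⟨R, fun d => ?_⟩
  apply Function.minimalPeriod_eq_prime
  · apply SimpleGraph.Dart.ext
    have h := d.adj.symm
    have h₁ : r (r d.snd d.fst) d.snd = d.fst := rotate _ _ h
    have h₂ : r d.fst (r d.snd d.fst) = d.snd := by
      have := rotate _ _ (mem _ _ h).symm
      rwa [h₁] at this
    change (r (r d.snd d.fst) d.snd, r (r (r d.snd d.fst) d.snd) (r d.snd d.fst)) =
      (d.fst, d.snd)
    rw [h₁, h₂]
  · intro h
    exact d.adj.ne (congrArg (fun e : G.Dart => e.fst) h).symm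

/-- Translation by `s` on two disjoint copies `{0, …, 7}` and `{8, …, 15}` of `ℤ/8ℤ`. -/
def shiftLayers (s v : Fin 16) : Fin 16 :=
  Fin.ofNat 16 (8 * (v.val / 8) + (v.val + s.val) % 8)

/-- The translation-invariant family of maps with the value `a` at the vertex `0` and `b` at the
vertex `8`. -/
def translationInvariant (a b : Fin 16 → Fin 16) (v u : Fin 16) : Fin 16 :=
  shiftLayers v ((if v < 8 then a else b) (shiftLayers (-v) u))

/-- The rotations of the first graph; non-neighbors are fixed. -/
def firstRotation : Fin 16 → Fin 16 → Fin 16 :=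
  translationInvariant
    ![0, 5, 10, 4, 7, 8, 11, 9, 6, 13, 1, 3, 12, 2, 14, 15]
    ![5, 1, 2, 12, 4, 3, 0, 6, 8, 9, 10, 11, 7, 13, 14, 15]

/-- The rotations of the second graph; non-neighbors are fixed. -/
def secondRotation : Fin 16 → Fin 16 → Fin 16 :=
  translationInvariant
    ![0, 1, 2, 3, 4, 5, 6, 7, 8, 9, 10, 11, 14, 13, 15, 12]
    ![0, 15, 14, 3, 11, 5, 6, 7, 8, 2, 4, 9, 12, 1, 13, 10]

/-- The complete graph on 16 vertices admits a triangular biembedding. -/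
theorem complete_graph_16_triangular_biembedding :
    ∃ G₁ G₂ : SimpleGraph (Fin 16),
      G₁ ⊔ G₂ = ⊤ ∧ G₁ ⊓ G₂ = ⊥ ∧
      (∃ R₁ : RotationSystem G₁, R₁.Triangular) ∧
      (∃ R₂ : RotationSystem G₂, R₂.Triangular) := by
  let G₁ : SimpleGraph (Fin 16) :=
    { Adj := fun v u => firstRotation v u ≠ u
      symm := ⟨by decide +kernel⟩
      loopless := ⟨by decide +kernel⟩ }
  let G₂ : SimpleGraph (Fin 16) :=
    { Adj := fun v u => secondRotation v u ≠ u
      symm := ⟨by decide +kernel⟩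
      loopless := ⟨by decide +kernel⟩ }
  have compl : ∀ v u : Fin 16,
      secondRotation v u ≠ u ↔ v ≠ u ∧ ¬ firstRotation v u ≠ u := by decide +kernel
  have hcompl : G₂ = G₁ᶜ := by
    ext v u
    exact (compl v u).trans (SimpleGraph.compl_adj G₁ v u).symm
  refine ⟨G₁, G₂, hcompl ▸ sup_compl_eq_top, hcompl ▸ inf_compl_eq_bot,
    exists_triangular_of_third_vertex G₁ firstRotation (fun _ _ => Iff.rfl) ?_ ?_ ?_,
    exists_triangular_of_third_vertex G₂ secondRotation (fun _ _ => Iff.rfl) ?_ ?_ ?_⟩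
  · change ∀ v u, firstRotation v u ≠ u → firstRotation v (firstRotation v u) ≠ firstRotation v u
    decide +kernel
  · change ∀ v u, firstRotation v u ≠ u → firstRotation (firstRotation v u) v = u
    decide +kernel
  · have cycle : ∀ v u w, firstRotation v u ≠ u → firstRotation v w ≠ w →
        ∃ k : Fin 12, (firstRotation v)^[k] u = w := by decide +kernel
    exact fun v u w hu hw => (cycle v u w hu hw).imp' Fin.val fun _ h => h
  · change ∀ v u, secondRotation v u ≠ u →
      secondRotation v (secondRotation v u) ≠ secondRotation v u
    decide +kernel
  · change ∀ v u, secondRotation v u ≠ u → secondRotation (secondRotation v u) v = u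
    decide +kernel
  · have cycle : ∀ v u w, secondRotation v u ≠ u → secondRotation v w ≠ w →
        ∃ k : Fin 9, (secondRotation v)^[k] u = w := by decide +kernel
    exact fun v u w hu hw => (cycle v u w hu hw).imp' Fin.val fun _ h => h
end

section
/- The complete graph K_24 admits a triangular biembedding: there exist two spanning subgraphs G₁ and G₂ of the complete graph on 24 vertices whose edge sets partition the edge set of K_24, each admitting a triangular rotation system. -/
namespace RotationSystem

variable {V : Type*}

/-- The graph in which the neighbors of `v` are the entries of the list `c v`. -/
def listGraph (c : V → List V) (symm : ∀ v, ∀ u ∈ c v, v ∈ c u) (irrefl : ∀ v, v ∉ c v) :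
    SimpleGraph V where
  Adj v u := u ∈ c v
  symm := ⟨fun v u h => symm v u h⟩
  loopless := ⟨irrefl⟩

/-- The rotation system which traverses the neighborhood of `v` in the cyclic order given by the
list `c v`. -/
def ofLists [DecidableEq V] (c : V → List V) (symm : ∀ v, ∀ u ∈ c v, v ∈ c u)
    (irrefl : ∀ v, v ∉ c v) (nodup : ∀ v, (c v).Nodup) :
    RotationSystem (listGraph c symm irrefl) where
  ρ v := (c v).formPerm
  mem_neighbor _ _ h := List.formPerm_apply_mem_of_mem h
  fixes _ _ h := List.formPerm_apply_of_notMem h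
  single_cycle v u w hu hw := by
    obtain ⟨i, hi, rfl⟩ := List.getElem_of_mem (show u ∈ c v from hu)
    obtain ⟨j, hj, rfl⟩ := List.getElem_of_mem (show w ∈ c v from hw)
    refine ⟨(c v).length - i + j, ?_⟩
    rw [List.formPerm_pow_apply_getElem _ (nodup v)]
    congr 1
    rw [show i + ((c v).length - i + j) = j + (c v).length by omega, Nat.add_mod_right,
      Nat.mod_eq_of_lt hj]

/-- A rotation system is triangular as soon as its rotations satisfy the rule: if `u` is followed
by `w` at `v`, then `v` is followed by `u` at `w`. -/
theorem triangular_of_rotation_rule {G : SimpleGraph V} (R : RotationSystem G)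
    (h : ∀ v u, G.Adj v u → R.ρ (R.ρ v u) v = u) : R.Triangular := by
  intro d
  have hperiod : Function.IsPeriodicPt R.facePerm 3 d := by
    have h₁ := h d.snd d.fst d.adj.symm
    have h₂ := h (R.ρ d.snd d.fst) d.snd (R.mem_neighbor _ _ d.adj.symm).symm
    rw [h₁] at h₂
    apply SimpleGraph.Dart.ext
    simp [facePerm, Function.iterate_succ, h₁, h₂]
  refine Function.minimalPeriod_eq_prime hperiod fun hfix => ?_
  exact d.adj.ne' (congrArg (fun e : G.Dart => e.fst) hfix)

end RotationSystem

/-- The cyclic orders of the neighborhoods in a triangulated 10-regular graph on `Fin 24`. The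
rotations are invariant under a regular action of the symmetric group `S₄`. -/
def sparseRotation : Fin 24 → List (Fin 24) :=
  ![[2, 3, 9, 22, 5, 11, 23, 13, 18, 7],
    [5, 6, 14, 7, 9, 16, 19, 18, 4, 12],
    [0, 7, 15, 16, 10, 6, 17, 19, 12, 3],
    [9, 0, 2, 12, 14, 21, 15, 4, 8, 17],
    [10, 11, 8, 3, 15, 22, 13, 12, 1, 18],
    [1, 12, 20, 21, 11, 0, 22, 15, 17, 6],
    [14, 1, 5, 17, 2, 10, 20, 8, 13, 22],
    [15, 2, 0, 18, 8, 20, 9, 1, 14, 23],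
    [11, 16, 13, 6, 20, 7, 18, 17, 3, 4],
    [3, 17, 23, 10, 16, 1, 7, 20, 22, 0],
    [4, 18, 21, 20, 6, 2, 16, 9, 23, 11],
    [8, 4, 10, 23, 0, 5, 21, 14, 19, 16],
    [20, 5, 1, 4, 13, 23, 14, 3, 2, 19],
    [16, 21, 18, 0, 23, 12, 4, 22, 6, 8],
    [6, 22, 19, 11, 21, 3, 12, 23, 7, 1],
    [7, 23, 17, 5, 22, 4, 3, 21, 16, 2],
    [13, 8, 11, 19, 1, 9, 10, 2, 15, 21],
    [23, 9, 3, 8, 18, 19, 2, 6, 5, 15],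
    [21, 10, 4, 1, 19, 17, 8, 7, 0, 13],
    [22, 20, 12, 2, 17, 18, 1, 16, 11, 14],
    [12, 19, 22, 9, 7, 8, 6, 10, 21, 5],
    [18, 13, 16, 15, 3, 14, 11, 5, 20, 10],
    [19, 14, 6, 13, 4, 15, 5, 0, 9, 20],
    [17, 15, 7, 14, 12, 13, 0, 11, 10, 9]]

/-- The cyclic orders of the neighborhoods in a triangulation of the complement of the graph given
by `sparseRotation`. -/
def denseRotation : Fin 24 → List (Fin 24) :=
  ![[1, 8, 19, 21, 12, 10, 14, 17, 16, 4, 6, 15, 20],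
    [3, 13, 15, 10, 17, 11, 2, 22, 21, 8, 0, 20, 23],
    [4, 14, 13, 20, 18, 5, 8, 23, 22, 1, 11, 9, 21],
    [6, 18, 20, 11, 22, 16, 5, 7, 10, 13, 1, 23, 19],
    [7, 19, 9, 5, 23, 6, 0, 16, 20, 14, 2, 21, 17],
    [8, 2, 18, 23, 4, 9, 13, 19, 7, 3, 16, 14, 10],
    [0, 4, 23, 16, 7, 21, 9, 12, 11, 18, 3, 19, 15],
    [11, 12, 21, 6, 16, 22, 10, 3, 5, 19, 4, 17, 13],
    [12, 15, 14, 9, 19, 0, 1, 21, 23, 2, 5, 10, 22],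
    [13, 5, 4, 19, 8, 14, 18, 15, 12, 6, 21, 2, 11],
    [14, 0, 12, 17, 1, 15, 19, 13, 3, 7, 22, 8, 5],
    [2, 1, 17, 22, 3, 20, 15, 18, 6, 12, 7, 13, 9],
    [16, 17, 10, 0, 21, 7, 11, 6, 9, 15, 8, 22, 18],
    [17, 20, 2, 14, 15, 1, 3, 10, 19, 5, 9, 11, 7],
    [18, 9, 8, 15, 13, 2, 4, 20, 17, 0, 10, 5, 16],
    [19, 10, 1, 13, 14, 8, 12, 9, 18, 11, 20, 0, 6],
    [5, 3, 22, 7, 6, 23, 20, 4, 0, 17, 12, 18, 14],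
    [21, 22, 11, 1, 10, 12, 16, 0, 14, 20, 13, 7, 4],
    [22, 23, 5, 2, 20, 3, 6, 11, 15, 9, 14, 16, 12],
    [23, 21, 0, 8, 9, 4, 7, 5, 13, 10, 15, 6, 3],
    [15, 11, 3, 18, 2, 13, 17, 14, 4, 16, 23, 1, 0],
    [9, 6, 7, 12, 0, 19, 23, 8, 1, 22, 17, 4, 2],
    [10, 7, 16, 3, 11, 17, 21, 1, 2, 23, 18, 12, 8],
    [20, 16, 6, 4, 5, 18, 22, 2, 8, 21, 19, 3, 1]]

/-- The complete graph on 24 vertices admits a triangular biembedding. -/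
theorem complete_graph_24_triangular_biembedding :
    ∃ G₁ G₂ : SimpleGraph (Fin 24),
      G₁ ⊔ G₂ = ⊤ ∧ G₁ ⊓ G₂ = ⊥ ∧
      (∃ R₁ : RotationSystem G₁, R₁.Triangular) ∧
      (∃ R₂ : RotationSystem G₂, R₂.Triangular) := by
  refine ⟨RotationSystem.listGraph sparseRotation (by decide +kernel) (by decide +kernel),
    RotationSystem.listGraph denseRotation (by decide +kernel) (by decide +kernel), ?_, ?_,
    ⟨RotationSystem.ofLists sparseRotation _ _ (by decide +kernel),
      RotationSystem.triangular_of_rotation_rule _ ?_⟩,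
    ⟨RotationSystem.ofLists denseRotation _ _ (by decide +kernel),
      RotationSystem.triangular_of_rotation_rule _ ?_⟩⟩
  · ext u v
    have h : ∀ u v : Fin 24, v ∈ sparseRotation u ∨ v ∈ denseRotation u ↔ u ≠ v := by
      decide +kernel
    exact h u v
  · ext u v
    have h : ∀ u v : Fin 24, ¬ (v ∈ sparseRotation u ∧ v ∈ denseRotation u) := by
      decide +kernel
    exact iff_of_false (h u v) id
  · have h : ∀ v, ∀ u ∈ sparseRotation v,
        (sparseRotation ((sparseRotation v).formPerm u)).formPerm v = u := by
      decide +kernel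
    exact h
  · have h : ∀ v, ∀ u ∈ denseRotation v,
        (denseRotation ((denseRotation v).formPerm u)).formPerm v = u := by
      decide +kernel
    exact h
end
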